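/- arXiv:1202.1029 — 4 statements merged into one kernel-verified Lean document; each statement's English description precedes it below -/
import Mathlib

section
/- Let a, b, c be real numbers such that none of the quantities a/3, (2+a−b)/2, (1+a+b)/2, 1+a−2c is a nonpositive integer, and such that all arguments of the Gamma functions appearing on the right-hand side are not nonpositive integers. Then ∑_{k=0}^∞ [(a)_k (1+a/3)_k (b)_k (1−b)_k (c)_k] / [k! · (a/3)_k · ((2+a−b)/2)_k · ((1+a+b)/2)_k · (1+a−2c)_k] · (1/4)^k = [Γ((1+a+b)/2) Γ(1+(a−b)/2) Γ((1+a)/2 − c) Γ(1+a/2 − c)] / [Γ((1+a)/2) Γ(1+a/2) Γ((1+a+b)/2 − c) Γ(1+(a−b)/2 − c)]. -/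
/-- The Pochhammer symbol `(x)ₖ = x (x+1) ⋯ (x+k-1)`, with `(x)₀ = 1`. -/
noncomputable def poch (x : ℝ) (k : ℕ) : ℝ :=
  ∏ i ∈ Finset.range k, (x + i)

/-- `x` is not a nonpositive integer (i.e. `x ∉ {0, -1, -2, …}`). -/
def NotNonposInt (x : ℝ) : Prop := ∀ n : ℕ, x ≠ -(n : ℝ)

open Filter Topology

theorem poch_succ (x : ℝ) (k : ℕ) : poch x (k + 1) = poch x k * (x + k) :=
  Finset.prod_range_succ _ _

theorem poch_add_one (x : ℝ) (k : ℕ) : x * poch (x + 1) k = poch x k * (x + k) := by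
  induction k with
  | zero => simp [poch]
  | succ k ih =>
    rw [poch_succ, poch_succ, ← mul_assoc, ih]
    push_cast
    ring

theorem NotNonposInt.add_nat_ne_zero {x : ℝ} (hx : NotNonposInt x) (k : ℕ) : x + k ≠ 0 :=
  fun h => hx k (by linarith)

theorem NotNonposInt.ne_zero {x : ℝ} (hx : NotNonposInt x) : x ≠ 0 := by
  simpa using hx.add_nat_ne_zero 0

theorem NotNonposInt.add_one {x : ℝ} (hx : NotNonposInt x) : NotNonposInt (x + 1) :=
  fun n h => hx (n + 1) (by push_cast; linarith)

theorem poch_ne_zero {x : ℝ} (hx : NotNonposInt x) (k : ℕ) : poch x k ≠ 0 :=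
  Finset.prod_ne_zero_iff.2 fun i _ => hx.add_nat_ne_zero i

/-- The summand of the Gessel–Stanton series without its very-well-poised factor `(a + 3k) / a`. -/
noncomputable def gsCore (a b c : ℝ) (k : ℕ) : ℝ :=
  poch a k * poch b k * poch (1 - b) k * poch c k /
    (k.factorial * poch (1 + (a - b) / 2) k * poch ((1 + a + b) / 2) k * poch (1 + a - 2 * c) k) *
    (1 / 4) ^ k

/-- The summand of the Gessel–Stanton series. -/
noncomputable def gsTerm (a b c : ℝ) (k : ℕ) : ℝ :=
  (a + 3 * k) / a * gsCore a b c k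

/-- The parameters for which no denominator of the Gessel–Stanton series vanishes. -/
structure GSRegular (a b c : ℝ) : Prop where
  num : NotNonposInt a
  den₁ : NotNonposInt (1 + (a - b) / 2)
  den₂ : NotNonposInt ((1 + a + b) / 2)
  den₃ : NotNonposInt (1 + a - 2 * c)

theorem GSRegular.add_two {a b c : ℝ} (h : GSRegular a b c) : GSRegular (a + 2) b c where
  num := by convert h.num.add_one.add_one using 1; ring
  den₁ := by convert h.den₁.add_one using 1; ring
  den₂ := by convert h.den₂.add_one using 1; ring
  den₃ := by convert h.den₃.add_one.add_one using 1; ring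

theorem GSRegular.add_two_mul {a b c : ℝ} (h : GSRegular a b c) (N : ℕ) :
    GSRegular (a + 2 * N) b c := by
  induction N with
  | zero => simpa using h
  | succ N ih => convert ih.add_two using 1; push_cast; ring

theorem GSRegular.add_three_mul_ne_zero {a b c : ℝ} (h : GSRegular a b c) (k : ℕ) :
    a + 3 * k ≠ 0 := by
  simpa using h.num.add_nat_ne_zero (3 * k)

theorem gsCore_succ {a b c : ℝ} (h : GSRegular a b c) (k : ℕ) :
    gsCore a b c (k + 1) = gsCore a b c k *
      ((a + k) * (b + k) * (1 - b + k) * (c + k) /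
        (4 * (k + 1) * (1 + (a - b) / 2 + k) * ((1 + a + b) / 2 + k) * (1 + a - 2 * c + k))) := by
  have hk : (k : ℝ) + 1 ≠ 0 := by positivity
  have hf : (k.factorial : ℝ) ≠ 0 := by positivity
  have hA := h.den₁.add_nat_ne_zero k
  have hB := h.den₂.add_nat_ne_zero k
  have hC := h.den₃.add_nat_ne_zero k
  have hA' := poch_ne_zero h.den₁ k
  have hB' := poch_ne_zero h.den₂ k
  have hC' := poch_ne_zero h.den₃ k
  simp only [gsCore, poch_succ, Nat.factorial_succ, pow_succ]
  push_cast
  generalize poch (1 + (a - b) / 2) k = PA at *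
  generalize poch ((1 + a + b) / 2) k = PB at *
  generalize poch (1 + a - 2 * c) k = PC at *
  generalize 1 + (a - b) / 2 + (k : ℝ) = A at *
  generalize (1 + a + b) / 2 + (k : ℝ) = B at *
  generalize 1 + a - 2 * c + (k : ℝ) = C at *
  field_simp

theorem gsCore_add_two {a b c : ℝ} (h : GSRegular a b c) (k : ℕ) :
    gsCore (a + 2) b c k = gsCore a b c k *
      ((a + k) * (a + 1 + k) / (a * (a + 1)) *
        ((1 + (a - b) / 2) * ((1 + a + b) / 2) * (1 + a - 2 * c) * (2 + a - 2 * c) /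
        ((1 + (a - b) / 2 + k) * ((1 + a + b) / 2 + k) * (1 + a - 2 * c + k) *
          (2 + a - 2 * c + k)))) := by
  have shift {x : ℝ} (hx : NotNonposInt x) : poch (x + 1) k = poch x k * ((x + k) / x) := by
    have := hx.ne_zero
    field_simp
    rw [poch_add_one]
  have e₁ : poch (a + 2) k = poch a k * ((a + k) / a) * ((a + 1 + k) / (a + 1)) := by
    rw [← shift h.num, ← shift h.num.add_one]; congr 1; ring
  have e₂ : poch (1 + (a + 2 - b) / 2) k =
      poch (1 + (a - b) / 2) k * ((1 + (a - b) / 2 + k) / (1 + (a - b) / 2)) := by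
    rw [← shift h.den₁]; congr 1; ring
  have e₃ : poch ((1 + (a + 2) + b) / 2) k =
      poch ((1 + a + b) / 2) k * (((1 + a + b) / 2 + k) / ((1 + a + b) / 2)) := by
    rw [← shift h.den₂]; congr 1; ring
  have e₄ : poch (1 + (a + 2) - 2 * c) k =
      poch (1 + a - 2 * c) k * ((1 + a - 2 * c + k) / (1 + a - 2 * c)) *
        ((2 + a - 2 * c + k) / (2 + a - 2 * c)) := by
    have e : 2 + a - 2 * c = 1 + a - 2 * c + 1 := by ring
    rw [e, ← shift h.den₃, ← shift h.den₃.add_one]; congr 1; ring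
  have hC₂ : NotNonposInt (2 + a - 2 * c) := by convert h.den₃.add_one using 1; ring
  have := h.num.ne_zero
  have := h.num.add_one.ne_zero
  have := h.den₁.ne_zero
  have := h.den₂.ne_zero
  have := h.den₃.ne_zero
  have := hC₂.ne_zero
  have hf : (k.factorial : ℝ) ≠ 0 := by positivity
  have hA := h.den₁.add_nat_ne_zero k
  have hB := h.den₂.add_nat_ne_zero k
  have hC := h.den₃.add_nat_ne_zero k
  have hD := hC₂.add_nat_ne_zero k
  have hA' := poch_ne_zero h.den₁ k
  have hB' := poch_ne_zero h.den₂ k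
  have hC' := poch_ne_zero h.den₃ k
  simp only [gsCore, e₁, e₂, e₃, e₄]
  generalize poch (1 + (a - b) / 2) k = PA at *
  generalize poch ((1 + a + b) / 2) k = PB at *
  generalize poch (1 + a - 2 * c) k = PC at *
  generalize 1 + (a - b) / 2 + (k : ℝ) = A at *
  generalize (1 + a + b) / 2 + (k : ℝ) = B at *
  generalize 1 + a - 2 * c + (k : ℝ) = C at *
  generalize 2 + a - 2 * c + (k : ℝ) = D at *
  generalize 1 + (a - b) / 2 = A' at *
  generalize (1 + a + b) / 2 = B' at *
  generalize 1 + a - 2 * c = C' at *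
  generalize 2 + a - 2 * c = D' at *
  field_simp

/-- The ratio of consecutive values, under `a ↦ a + 2`, of the Gamma quotient. -/
noncomputable def gsRatio (a b c : ℝ) : ℝ :=
  ((1 + a) / 2 * (1 + a / 2) * ((1 + a + b) / 2 - c) * (1 + (a - b) / 2 - c)) /
    ((1 + a + b) / 2 * (1 + (a - b) / 2) * ((1 + a) / 2 - c) * (1 + a / 2 - c))

/-- The Wilf–Zeilberger mate of `gsTerm` for the shift `a ↦ a + 2`. -/
noncomputable def gsMate (a b c : ℝ) (k : ℕ) : ℝ :=
  k * (4 * c - 4 * a - 2 - 4 * k) / (a * (1 + a - 2 * c + k)) * gsCore a b c k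

theorem gsRatio_eq (a b c : ℝ) :
    gsRatio a b c =
      ((1 + a) * (2 + a) * (1 + a + b - 2 * c) * (2 + a - b - 2 * c)) /
        ((1 + a + b) * (2 + a - b) * (1 + a - 2 * c) * (2 + a - 2 * c)) := by
  rw [gsRatio, ← mul_div_mul_left _ _ (by norm_num : (16 : ℝ) ≠ 0)]
  congr 1 <;> ring

theorem gsTerm_sub_eq_gsMate_sub {a b c : ℝ} (h : GSRegular a b c) (k : ℕ) :
    gsTerm a b c k - gsRatio a b c * gsTerm (a + 2) b c k =
      gsMate a b c (k + 1) - gsMate a b c k := by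
  have hC₂ : NotNonposInt (2 + a - 2 * c) := by convert h.den₃.add_one using 1; ring
  have := h.num.ne_zero
  have := h.num.add_one.ne_zero
  have := h.add_two.num.ne_zero
  have eA : 1 + (a - b) / 2 = (2 + a - b) / 2 := by ring
  have eA' : (2 + a - b) / 2 + k = (2 + a - b + 2 * k) / 2 := by ring
  have eB' : (1 + a + b) / 2 + k = (1 + a + b + 2 * k) / 2 := by ring
  have hA₀ : 2 + a - b ≠ 0 := fun h' => h.den₁.ne_zero (by rw [eA, h', zero_div])
  have hB₀ : 1 + a + b ≠ 0 := fun h' => h.den₂.ne_zero (by rw [h', zero_div])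
  have := h.den₃.ne_zero
  have := hC₂.ne_zero
  have hk : (k : ℝ) + 1 ≠ 0 := by positivity
  have hA : 2 + a - b + 2 * k ≠ 0 :=
    fun h' => h.den₁.add_nat_ne_zero k (by rw [eA, eA', h', zero_div])
  have hB : 1 + a + b + 2 * k ≠ 0 :=
    fun h' => h.den₂.add_nat_ne_zero k (by rw [eB', h', zero_div])
  have hC := h.den₃.add_nat_ne_zero k
  have hD := hC₂.add_nat_ne_zero k
  have eD : 1 + a - 2 * c + ((k : ℝ) + 1) = 2 + a - 2 * c + k := by ring
  rw [gsTerm, gsTerm, gsMate, gsMate, gsCore_succ h, gsCore_add_two h, gsRatio_eq]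
  push_cast
  rw [eA, eA', eB', eD]
  obtain ⟨P, hP⟩ : ∃ P, P = 2 + a - b + 2 * k := ⟨_, rfl⟩
  obtain ⟨Q, hQ⟩ : ∃ Q, Q = 1 + a + b + 2 * k := ⟨_, rfl⟩
  rw [← hP] at hA ⊢
  rw [← hQ] at hB ⊢
  field_simp
  subst hP hQ
  ring

theorem gsTerm_zero {a : ℝ} (ha : a ≠ 0) (b c : ℝ) : gsTerm a b c 0 = 1 := by
  simp [gsTerm, gsCore, poch, ha]

/-- The ratio of consecutive summands of the Gessel–Stanton series. -/
noncomputable def gsTermRatio (a b c : ℝ) (k : ℕ) : ℝ :=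
  (a + 3 + 3 * k) / (a + 3 * k) * ((a + k) / (1 + a - 2 * c + k)) *
    ((b + k) / ((1 + a + b) / 2 + k)) *
    ((1 - b + k) / (1 + (a - b) / 2 + k) * ((c + k) / (1 + k))) / 4

theorem gsTerm_succ {a b c : ℝ} (h : GSRegular a b c) (k : ℕ) :
    gsTerm a b c (k + 1) = gsTermRatio a b c k * gsTerm a b c k := by
  have h₀ := h.num.ne_zero
  have h₁ := h.add_three_mul_ne_zero k
  rw [gsTerm, gsTerm, gsCore_succ h, gsTermRatio]
  push_cast
  have hk : (k : ℝ) + 1 ≠ 0 := by positivity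
  have hA := h.den₁.add_nat_ne_zero k
  have hB := h.den₂.add_nat_ne_zero k
  have hC := h.den₃.add_nat_ne_zero k
  rw [add_comm 1 (k : ℝ)]
  generalize 1 + (a - b) / 2 + (k : ℝ) = A at *
  generalize (1 + a + b) / 2 + (k : ℝ) = B at *
  generalize 1 + a - 2 * c + (k : ℝ) = C at *
  field_simp
  ring

theorem tendsto_gsTermRatio (a b c : ℝ) :
    Tendsto (gsTermRatio a b c) atTop (𝓝 (1 / 4)) := by
  have lim (x y : ℝ) : Tendsto (fun k : ℕ => (x + k) / (y + k)) atTop (𝓝 1) := by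
    simpa using tendsto_add_mul_div_add_mul_atTop_nhds x y 1 (one_ne_zero (α := ℝ))
  have lim₃ := tendsto_add_mul_div_add_mul_atTop_nhds (a + 3) a 3 (three_ne_zero (α := ℝ))
  have := ((((lim₃.mul (lim a (1 + a - 2 * c))).mul (lim b ((1 + a + b) / 2))).mul
    ((lim (1 - b) (1 + (a - b) / 2)).mul (lim c 1))).div_const 4)
  norm_num at this
  exact this

theorem GSRegular.summable_gsTerm {a b c : ℝ} (h : GSRegular a b c) : Summable (gsTerm a b c) := by
  refine summable_of_ratio_norm_eventually_le (r := 1 / 2) (by norm_num) ?_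
  have := (tendsto_gsTermRatio a b c).norm.eventually_le_const
    (u := 1 / 2) (by norm_num [abs_of_pos])
  filter_upwards [this] with k hk
  rw [gsTerm_succ h, norm_mul]
  gcongr

theorem GSRegular.tendsto_gsMate {a b c : ℝ} (h : GSRegular a b c) :
    Tendsto (gsMate a b c) atTop (𝓝 0) := by
  have lim₁ := tendsto_add_mul_div_add_mul_atTop_nhds 0 (1 + a - 2 * c) 1 (one_ne_zero (α := ℝ))
  have lim₂ := tendsto_add_mul_div_add_mul_atTop_nhds (4 * c - 4 * a - 2) a (-4)
    (three_ne_zero (α := ℝ))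
  have := (lim₁.mul lim₂).mul h.summable_gsTerm.tendsto_atTop_zero
  rw [mul_zero] at this
  refine this.congr fun k => ?_
  have h₀ := h.num.ne_zero
  have h₁ := h.add_three_mul_ne_zero k
  have h₂ := h.den₃.add_nat_ne_zero k
  rw [gsMate, gsTerm, zero_add, one_mul]
  generalize a + 3 * (k : ℝ) = D at *
  field_simp
  ring

theorem GSRegular.tsum_gsTerm_eq_mul {a b c : ℝ} (h : GSRegular a b c) :
    ∑' k, gsTerm a b c k = gsRatio a b c * ∑' k, gsTerm (a + 2) b c k := by
  have hs := h.summable_gsTerm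
  have hs' := h.add_two.summable_gsTerm.mul_left (gsRatio a b c)
  have lim := (hs.sub hs').hasSum.tendsto_sum_nat
  have lim₀ : Tendsto (fun n => ∑ k ∈ Finset.range n,
      (gsTerm a b c k - gsRatio a b c * gsTerm (a + 2) b c k)) atTop (𝓝 0) := by
    refine h.tendsto_gsMate.congr fun n => ?_
    simp_rw [gsTerm_sub_eq_gsMate_sub h]
    rw [Finset.sum_range_sub]
    simp [gsMate]
  have := tendsto_nhds_unique lim lim₀
  rwa [hs.tsum_sub hs', tsum_mul_left, sub_eq_zero] at this

/-- The product of `gsRatio` over the parameters `a, a + 2, …, a + 2 (N - 1)`. -/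
noncomputable def gsRatioProd (a b c : ℝ) (N : ℕ) : ℝ :=
  (poch ((1 + a) / 2) N * poch (1 + a / 2) N * poch ((1 + a + b) / 2 - c) N *
      poch (1 + (a - b) / 2 - c) N) /
    (poch ((1 + a + b) / 2) N * poch (1 + (a - b) / 2) N * poch ((1 + a) / 2 - c) N *
      poch (1 + a / 2 - c) N)

theorem gsRatioProd_succ (a b c : ℝ) (N : ℕ) :
    gsRatioProd a b c (N + 1) = gsRatioProd a b c N * gsRatio (a + 2 * N) b c := by
  rw [gsRatioProd, gsRatioProd, gsRatio, div_mul_div_comm]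
  simp only [poch_succ]
  congr 1 <;> ring

theorem GSRegular.tsum_gsTerm_eq_gsRatioProd_mul {a b c : ℝ} (h : GSRegular a b c) (N : ℕ) :
    ∑' k, gsTerm a b c k = gsRatioProd a b c N * ∑' k, gsTerm (a + 2 * N) b c k := by
  induction N with
  | zero => simp [gsRatioProd, poch]
  | succ N ih =>
    rw [ih, (h.add_two_mul N).tsum_gsTerm_eq_mul, gsRatioProd_succ]
    push_cast
    ring_nf

theorem abs_gsTermRatio_le {a b c : ℝ} (ha : 12 ≤ a) (hc : 10 * |c| ≤ a) (hb : 3 * |b| ≤ a)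
    (hbc : |b| + 2 * (|c| + |1 - b| + |c| * |1 - b|) ≤ a) (k : ℕ) :
    |gsTermRatio a b c k| ≤ 1 / 2 := by
  have hk : (0 : ℝ) ≤ k := k.cast_nonneg
  have b₁ := le_abs_self b
  have b₂ := neg_abs_le b
  have c₁ := le_abs_self c
  have c₂ := abs_nonneg c
  have d₂ := abs_nonneg (1 - b)
  have cd := mul_nonneg c₂ d₂
  have f₁ : |(a + 3 + 3 * k) / (a + 3 * k)| ≤ 5 / 4 := by
    rw [abs_of_nonneg (by positivity), div_le_div_iff₀ (by positivity) (by norm_num)]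
    linarith
  have f₂ : |(a + k) / (1 + a - 2 * c + k)| ≤ 5 / 4 := by
    have : 0 < 1 + a - 2 * c + k := by linarith
    rw [abs_of_nonneg (by positivity), div_le_div_iff₀ this (by norm_num)]
    linarith
  have f₃ : |(b + k) / ((1 + a + b) / 2 + k)| ≤ 1 := by
    have : 0 < (1 + a + b) / 2 + k := by linarith
    rw [abs_div, abs_of_pos this, div_le_one this, abs_le]
    constructor <;> linarith
  have f₄ : |(1 - b + k) / (1 + (a - b) / 2 + k) * ((c + k) / (1 + k))| ≤ 1 := by
    have : 0 < 1 + (a - b) / 2 + k := by linarith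
    have hk₁ : (0 : ℝ) < 1 + k := by positivity
    rw [div_mul_div_comm, abs_div, abs_mul, abs_of_pos (mul_pos this hk₁),
      div_le_one (mul_pos this hk₁)]
    have g₁ := abs_add_le (1 - b) k
    have g₂ := abs_add_le c k
    rw [Nat.abs_cast] at g₁ g₂
    calc |1 - b + k| * |c + k| ≤ (|1 - b| + k) * (|c| + k) := by gcongr
      _ ≤ (1 + (a - b) / 2 + k) * (1 + k) := by nlinarith
  rw [gsTermRatio, abs_div, abs_mul, abs_mul, abs_mul, abs_of_pos (by norm_num : (0 : ℝ) < 4)]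
  calc _ ≤ 5 / 4 * (5 / 4) * 1 * 1 / (4 : ℝ) := by gcongr
    _ ≤ 1 / 2 := by norm_num

theorem GSRegular.abs_tsum_gsTerm_sub_one_le {a b c : ℝ} (h : GSRegular a b c)
    (hr : ∀ k, |gsTermRatio a b c k| ≤ 1 / 2) :
    |∑' k, gsTerm a b c k - 1| ≤ |gsTermRatio a b c 0| * 2 := by
  have bound (k : ℕ) : ‖gsTerm a b c (k + 1)‖ ≤ |gsTermRatio a b c 0| * (1 / 2) ^ k := by
    induction k with
    | zero => simp [gsTerm_succ h, gsTerm_zero h.num.ne_zero]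
    | succ k ih =>
      rw [gsTerm_succ h, norm_mul, pow_succ]
      calc _ ≤ 1 / 2 * (|gsTermRatio a b c 0| * (1 / 2) ^ k) := by
            gcongr
            exact hr _
        _ = _ := by ring
  rw [h.summable_gsTerm.tsum_eq_zero_add, gsTerm_zero h.num.ne_zero, add_sub_cancel_left]
  exact tsum_of_norm_bounded (hasSum_geometric_two.mul_left _) bound

theorem tendsto_gsTermRatio_zero (a b c : ℝ) :
    Tendsto (fun N : ℕ => gsTermRatio (a + 2 * N) b c 0) atTop (𝓝 0) := by
  have l₁ := tendsto_add_mul_div_add_mul_atTop_nhds (a + 3) a 2 (two_ne_zero (α := ℝ))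
  have l₂ := tendsto_add_mul_div_add_mul_atTop_nhds a (1 + a - 2 * c) 2 (two_ne_zero (α := ℝ))
  have l₃ := tendsto_add_mul_div_add_mul_atTop_nhds b ((1 + a + b) / 2) 0 (one_ne_zero (α := ℝ))
  have l₄ := tendsto_add_mul_div_add_mul_atTop_nhds (1 - b) (1 + (a - b) / 2) 0
    (one_ne_zero (α := ℝ))
  have := (((l₁.mul l₂).mul l₃).mul (l₄.mul_const c)).div_const 4
  norm_num at this
  refine this.congr fun N => ?_
  simp only [gsTermRatio, Nat.cast_zero, mul_zero, add_zero, div_one]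
  ring_nf

theorem GSRegular.tendsto_tsum_gsTerm {a b c : ℝ} (h : GSRegular a b c) :
    Tendsto (fun N : ℕ => ∑' k, gsTerm (a + 2 * N) b c k) atTop (𝓝 1) := by
  have ha : Tendsto (fun N : ℕ => a + 2 * (N : ℝ)) atTop atTop :=
    tendsto_atTop_add_const_left _ _
      (tendsto_natCast_atTop_atTop.const_mul_atTop (by norm_num))
  rw [tendsto_iff_dist_tendsto_zero]
  refine squeeze_zero' (Eventually.of_forall fun _ => dist_nonneg) ?_
    (by simpa using (tendsto_gsTermRatio_zero a b c).abs.mul_const 2)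
  filter_upwards [ha.eventually_ge_atTop 12, ha.eventually_ge_atTop (10 * |c|),
    ha.eventually_ge_atTop (3 * |b|),
    ha.eventually_ge_atTop (|b| + 2 * (|c| + |1 - b| + |c| * |1 - b|))] with N h₁ h₂ h₃ h₄
  exact (h.add_two_mul N).abs_tsum_gsTerm_sub_one_le (abs_gsTermRatio_le h₁ h₂ h₃ h₄)

theorem poch_succ_eq_div_GammaSeq (x : ℝ) {n : ℕ} (hn : n ≠ 0) :
    poch x (n + 1) = (n : ℝ) ^ x * n.factorial / Real.GammaSeq x n := by
  have h₁ : ((n : ℝ) ^ x * n.factorial) ≠ 0 := by positivity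
  rw [Real.GammaSeq, div_div_cancel₀ h₁, poch]

theorem tendsto_gsRatioProd {a b c : ℝ}
    (hx : NotNonposInt ((1 + a) / 2)) (hy : NotNonposInt (1 + a / 2))
    (hA' : NotNonposInt (1 + (a - b) / 2 - c)) (hB' : NotNonposInt ((1 + a + b) / 2 - c)) :
    Tendsto (gsRatioProd a b c) atTop
      (𝓝 ((Real.Gamma ((1 + a + b) / 2) * Real.Gamma (1 + (a - b) / 2) *
          Real.Gamma ((1 + a) / 2 - c) * Real.Gamma (1 + a / 2 - c)) /
        (Real.Gamma ((1 + a) / 2) * Real.Gamma (1 + a / 2) *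
          Real.Gamma ((1 + a + b) / 2 - c) * Real.Gamma (1 + (a - b) / 2 - c)))) := by
  have lim := Real.GammaSeq_tendsto_Gamma
  rw [← tendsto_add_atTop_iff_nat 1]
  refine ((((lim _).mul (lim _)).mul (lim _)).mul (lim _) |>.div
    ((((lim _).mul (lim _)).mul (lim _)).mul (lim _)) ?_).congr' ?_
  · exact mul_ne_zero (mul_ne_zero (mul_ne_zero (Real.Gamma_ne_zero hx) (Real.Gamma_ne_zero hy))
      (Real.Gamma_ne_zero hB')) (Real.Gamma_ne_zero hA')
  · filter_upwards [eventually_ne_atTop 0] with n hn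
    have hn₀ : (0 : ℝ) < n := by positivity
    have e₁ : (n : ℝ) ^ ((1 + a) / 2) * (n : ℝ) ^ (1 + a / 2) =
        (n : ℝ) ^ ((1 + a + b) / 2) * (n : ℝ) ^ (1 + (a - b) / 2) := by
      rw [← Real.rpow_add hn₀, ← Real.rpow_add hn₀]
      ring_nf
    have e₂ : (n : ℝ) ^ ((1 + a + b) / 2 - c) * (n : ℝ) ^ (1 + (a - b) / 2 - c) =
        (n : ℝ) ^ ((1 + a) / 2 - c) * (n : ℝ) ^ (1 + a / 2 - c) := by
      rw [← Real.rpow_add hn₀, ← Real.rpow_add hn₀]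
      ring_nf
    have pos (s : ℝ) : (n : ℝ) ^ s ≠ 0 := by positivity
    have p₁ := pos ((1 + a + b) / 2)
    have p₂ := pos (1 + (a - b) / 2)
    have p₃ := pos ((1 + a) / 2 - c)
    have p₄ := pos (1 + a / 2 - c)
    simp only [gsRatioProd, poch_succ_eq_div_GammaSeq _ hn, Pi.div_apply]
    generalize (n : ℝ) ^ ((1 + a) / 2) = q₁ at *
    generalize (n : ℝ) ^ (1 + a / 2) = q₂ at *
    generalize (n : ℝ) ^ ((1 + a + b) / 2 - c) = q₃ at *
    generalize (n : ℝ) ^ (1 + (a - b) / 2 - c) = q₄ at *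
    generalize (n : ℝ) ^ ((1 + a + b) / 2) = r₁ at *
    generalize (n : ℝ) ^ (1 + (a - b) / 2) = r₂ at *
    generalize (n : ℝ) ^ ((1 + a) / 2 - c) = r₃ at *
    generalize (n : ℝ) ^ (1 + a / 2 - c) = r₄ at *
    generalize Real.GammaSeq _ n = g₁, Real.GammaSeq _ n = g₂, Real.GammaSeq _ n = g₃,
      Real.GammaSeq _ n = g₄, Real.GammaSeq _ n = g₅, Real.GammaSeq _ n = g₆,
      Real.GammaSeq _ n = g₇, Real.GammaSeq _ n = g₈
    have cancel : q₁ * q₂ * (q₃ * q₄) / (r₁ * r₂ * (r₃ * r₄)) = 1 := by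
      rw [e₁, e₂]
      exact div_self (by simp [p₁, p₂, p₃, p₄])
    have cancel' : (n.factorial : ℝ) ^ 4 / (n.factorial : ℝ) ^ 4 = 1 := div_self (by positivity)
    rw [← one_mul (_ / _), ← cancel, ← one_mul (_ * _), ← cancel']
    simp only [div_eq_mul_inv, mul_inv, inv_inv]
    ring

/-- The limiting case `n → ∞` of the Gessel–Stanton identity: a `₅F₄`
evaluation at argument `1/4`. -/
theorem gessel_stanton_limit (a b c : ℝ)
    (h1 : NotNonposInt (a / 3))
    (h2 : NotNonposInt ((2 + a - b) / 2))
    (h3 : NotNonposInt ((1 + a + b) / 2))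
    (h4 : NotNonposInt (1 + a - 2 * c))
    (h5 : NotNonposInt (1 + (a - b) / 2))
    (h6 : NotNonposInt ((1 + a) / 2 - c))
    (h7 : NotNonposInt (1 + a / 2 - c))
    (h8 : NotNonposInt ((1 + a) / 2))
    (h9 : NotNonposInt (1 + a / 2))
    (h10 : NotNonposInt ((1 + a + b) / 2 - c))
    (h11 : NotNonposInt (1 + (a - b) / 2 - c)) :
    ∑' k : ℕ,
        (poch a k * poch (1 + a / 3) k * poch b k * poch (1 - b) k * poch c k) /
          ((k.factorial : ℝ) * poch (a / 3) k * poch ((2 + a - b) / 2) k *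
            poch ((1 + a + b) / 2) k * poch (1 + a - 2 * c) k) *
          (1 / 4 : ℝ) ^ k =
      (Real.Gamma ((1 + a + b) / 2) * Real.Gamma (1 + (a - b) / 2) *
          Real.Gamma ((1 + a) / 2 - c) * Real.Gamma (1 + a / 2 - c)) /
        (Real.Gamma ((1 + a) / 2) * Real.Gamma (1 + a / 2) *
          Real.Gamma ((1 + a + b) / 2 - c) * Real.Gamma (1 + (a - b) / 2 - c)) := by
  have hNum : NotNonposInt a := by
    intro n hn
    obtain ⟨m, rfl | rfl⟩ := n.even_or_odd'
    · cases m with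
      | zero => exact h1 0 (by simp [hn])
      | succ m => exact h9 m (by rw [hn]; push_cast; ring)
    · exact h8 m (by rw [hn]; push_cast; ring)
  have h : GSRegular a b c := ⟨hNum, h5, h3, h4⟩
  have term_eq (k : ℕ) : (poch a k * poch (1 + a / 3) k * poch b k * poch (1 - b) k * poch c k) /
      ((k.factorial : ℝ) * poch (a / 3) k * poch ((2 + a - b) / 2) k *
        poch ((1 + a + b) / 2) k * poch (1 + a - 2 * c) k) * (1 / 4 : ℝ) ^ k =
      gsTerm a b c k := by
    have e₁ : (2 + a - b) / 2 = 1 + (a - b) / 2 := by ring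
    have e₂ : poch (1 + a / 3) k = (a + 3 * k) / a * poch (a / 3) k := by
      have := poch_add_one (a / 3) k
      have ha := hNum.ne_zero
      rw [add_comm (a / 3) 1] at this
      field_simp at this ⊢
      linarith
    have hp := poch_ne_zero h1 k
    rw [e₁, e₂, ← mul_div_cancel_right₀ (gsTerm a b c k) hp, gsTerm, gsCore]
    ring
  simp_rw [term_eq]
  have lim := (tendsto_gsRatioProd h8 h9 h11 h10).mul h.tendsto_tsum_gsTerm
  rw [mul_one] at lim
  exact tendsto_nhds_unique
    (tendsto_const_nhds.congr fun N => h.tsum_gsTerm_eq_gsRatioProd_mul N) lim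
end

section
/- Let a, b be real numbers such that none of the quantities 3a/4, 1+a−b, (1+3a+3b)/2, (3a+3b)/2 is a nonpositive integer, and such that all arguments of the Gamma functions appearing on the right-hand side are not nonpositive integers. Then ∑_{k=0}^∞ [(3a)_k (1+3a/4)_k (3b)_k ((1−3b)/2)_k ((2−3b)/2)_k] / [k! · (3a/4)_k · (1+a−b)_k · ((1+3a+3b)/2)_k · ((3a+3b)/2)_k] · (1/9)^k = [Γ(1+a−b) Γ(a+b) Γ(a+b+1/3) Γ(a+b+2/3)] / [Γ(a+2b) Γ(a+1/3) Γ(a+2/3) Γ(a+1)]. -/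
open Filter Topology

/-- The summand of the `₅F₄` series. -/
noncomputable def gasperTerm (a b : ℝ) (k : ℕ) : ℝ :=
  (poch (3 * a) k * poch (1 + 3 * a / 4) k * poch (3 * b) k *
      poch ((1 - 3 * b) / 2) k * poch ((2 - 3 * b) / 2) k) /
    ((k.factorial : ℝ) * poch (3 * a / 4) k * poch (1 + a - b) k *
      poch ((1 + 3 * a + 3 * b) / 2) k * poch ((3 * a + 3 * b) / 2) k) *
    (1 / 9 : ℝ) ^ k

/-- The quotient of consecutive summands of the `₅F₄` series. -/
noncomputable def gasperRatio (a b x : ℝ) : ℝ :=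
  (3 * a + x) * (3 * a + 4 * x + 4) * (3 * b + x) * (1 - 3 * b + 2 * x) * (2 - 3 * b + 2 * x) /
    (9 * (x + 1) * (3 * a + 4 * x) * (1 + a - b + x) * (3 * a + 3 * b + 2 * x + 1) *
      (3 * a + 3 * b + 2 * x))

/-- The factor relating the sum at `a` to the sum at `a + 1`. -/
noncomputable def gasperShift (a b : ℝ) : ℝ :=
  ((a + 2 * b) * (a + 1 / 3) * (a + 2 / 3) * (a + 1)) /
    ((1 + a - b) * (a + b) * (a + b + 1 / 3) * (a + b + 2 / 3))

/-- The telescoping companion of `gasperTerm`. -/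
noncomputable def gasperCert (a b : ℝ) (k : ℕ) : ℝ :=
  -9 * (k * (2 * a + b + k) / ((3 * a + 3 * b + 2 * k) * (3 * a + 4 * k))) * gasperTerm a b k

lemma gasperTerm_zero (a b : ℝ) : gasperTerm a b 0 = 1 := by
  simp [gasperTerm, poch]

lemma gasperTerm_succ (a b : ℝ) (k : ℕ) :
    gasperTerm a b (k + 1) = gasperTerm a b k * gasperRatio a b k := by
  have h : gasperRatio a b k =
      ((3 * a + k) * (1 + 3 * a / 4 + k) * (3 * b + k) * ((1 - 3 * b) / 2 + k) *
        ((2 - 3 * b) / 2 + k)) / ((k + 1) * (3 * a / 4 + k) * (1 + a - b + k) *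
          ((1 + 3 * a + 3 * b) / 2 + k) * ((3 * a + 3 * b) / 2 + k)) * (1 / 9) := by
    rw [gasperRatio, show 3 * a / 4 + (k : ℝ) = (3 * a + 4 * k) / 4 by ring,
      show (1 + 3 * a + 3 * b) / 2 + (k : ℝ) = (3 * a + 3 * b + 2 * k + 1) / 2 by ring,
      show (3 * a + 3 * b) / 2 + (k : ℝ) = (3 * a + 3 * b + 2 * k) / 2 by ring]
    simp only [div_eq_mul_inv, mul_inv]
    ring
  rw [h]
  simp only [gasperTerm, poch, Finset.prod_range_succ, Nat.factorial_succ, pow_succ, Nat.cast_mul,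
    Nat.cast_add, Nat.cast_one, div_eq_mul_inv, mul_inv]
  ring

section Recurrence

variable {a b : ℝ}

lemma gasperShift_mul_term (ha : ∀ k : ℕ, 3 * a + k ≠ 0) (hab : ∀ k : ℕ, 1 + a - b + k ≠ 0)
    (hs : ∀ k : ℕ, 3 * a + 3 * b + k ≠ 0) (k : ℕ) :
    gasperShift a b * gasperTerm (a + 1) b k =
      gasperTerm a b k * ((a + 2 * b) * (3 * a + k) * (3 * a + k + 1) * (3 * a + k + 2) *
        (3 * a + 3 + 4 * k) / ((3 * a + 4 * k) * (1 + a - b + k) * (3 * a + 3 * b + 2 * k) *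
          (3 * a + 3 * b + 2 * k + 1) * (3 * a + 3 * b + 2 * k + 2))) := by
  induction k with
  | zero =>
    have e1 : a + b ≠ 0 := fun h ↦ hs 0 (by push_cast; linarith)
    have e2 : 3 * a + 3 * b + 1 ≠ 0 := mod_cast hs 1
    have e3 : 3 * a + 3 * b + 2 ≠ 0 := mod_cast hs 2
    have e4 : 1 + a - b ≠ 0 := by simpa using hab 0
    have e5 : a ≠ 0 := by simpa using ha 0
    rw [gasperTerm_zero, gasperTerm_zero, gasperShift,
      show a + b + 1 / 3 = (3 * a + 3 * b + 1) / 3 by ring,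
      show a + b + 2 / 3 = (3 * a + 3 * b + 2) / 3 by ring, Nat.cast_zero]
    simp only [add_zero, mul_zero]
    rw [← mul_add] at *
    field_simp
  | succ k ih =>
    rw [gasperTerm_succ, gasperTerm_succ, ← mul_assoc, ih,
      mul_assoc (gasperTerm a b k), mul_assoc (gasperTerm a b k)]
    congr 1
    have e1 : 3 * a + 3 + 4 * (k : ℝ) ≠ 0 := by
      convert ha (4 * k + 3) using 1; push_cast; ring
    have e2 : 3 * a + 4 * (k : ℝ) + 4 ≠ 0 := by
      convert ha (4 * k + 4) using 1; push_cast; ring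
    rw [gasperRatio, gasperRatio, div_mul_div_comm, div_mul_div_comm]
    push_cast
    generalize (k : ℝ) = x at *
    trans ((a + 2 * b) * (3 * a + x) * (3 * a + x + 1) * (3 * a + x + 2) * (3 * a + x + 3) *
        (3 * a + 4 * x + 7) * (3 * b + x) * (1 - 3 * b + 2 * x) * (2 - 3 * b + 2 * x)) /
      (9 * (x + 1) * (3 * a + 4 * x) * (1 + a - b + x) * (2 + a - b + x) *
        (3 * a + 3 * b + 2 * x) * (3 * a + 3 * b + 2 * x + 1) * (3 * a + 3 * b + 2 * x + 2) *
        (3 * a + 3 * b + 2 * x + 3) * (3 * a + 3 * b + 2 * x + 4))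
    · refine Eq.trans ?_ (mul_div_mul_right _ _ e1)
      congr 1 <;> ring
    · refine (mul_div_mul_right _ _ e2).symm.trans ?_
      congr 1 <;> ring

lemma gasperTerm_sub_shift (ha : ∀ k : ℕ, 3 * a + k ≠ 0) (hab : ∀ k : ℕ, 1 + a - b + k ≠ 0)
    (hs : ∀ k : ℕ, 3 * a + 3 * b + k ≠ 0) (k : ℕ) :
    gasperTerm a b k - gasperShift a b * gasperTerm (a + 1) b k =
      gasperCert a b (k + 1) - gasperCert a b k := by
  rw [gasperShift_mul_term ha hab hs, gasperCert, gasperCert, gasperTerm_succ, gasperRatio]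
  have e1 : 3 * a + 3 * b + 2 * (k : ℝ) ≠ 0 := mod_cast hs (2 * k)
  have e2 : 3 * a + 3 * b + 2 * (k : ℝ) + 1 ≠ 0 := by
    convert hs (2 * k + 1) using 1; push_cast; ring
  have e3 : 3 * a + 3 * b + 2 * (k : ℝ) + 2 ≠ 0 := by
    convert hs (2 * k + 2) using 1; push_cast; ring
  have e4 := hab k
  have e5 : 3 * a + 4 * (k : ℝ) ≠ 0 := mod_cast ha (4 * k)
  have e6 : 3 * a + 4 * (k : ℝ) + 4 ≠ 0 := by
    convert ha (4 * k + 4) using 1; push_cast; ring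
  have e7 : (k : ℝ) + 1 ≠ 0 := by positivity
  push_cast
  generalize (k : ℝ) = x at *
  rw [show 3 * a + 3 * b + 2 * (x + 1) = 3 * a + 3 * b + 2 * x + 2 by ring,
    show 3 * a + 4 * (x + 1) = 3 * a + 4 * x + 4 by ring]
  obtain ⟨p, hp⟩ : ∃ p, p = 3 * a + 3 * b + 2 * x := ⟨_, rfl⟩
  obtain ⟨d, hd⟩ : ∃ d, d = 3 * a + 4 * x := ⟨_, rfl⟩
  obtain ⟨w, hw⟩ : ∃ w, w = 1 + a - b + x := ⟨_, rfl⟩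
  rw [← hp] at e1 e2 e3 ⊢
  rw [← hd] at e5 e6 ⊢
  rw [← hw] at e4 ⊢
  field_simp
  rw [hp, hd, hw]
  ring

end Recurrence

lemma tendsto_affine_div_affine (p q r s : ℝ) (hr : r ≠ 0) :
    Tendsto (fun k : ℕ ↦ (p + q * k) / (s + r * k)) atTop (𝓝 (q / r)) := by
  have h (u v : ℝ) : Tendsto (fun k : ℕ ↦ u / (k : ℝ) + v) atTop (𝓝 v) := by
    simpa using (tendsto_const_div_atTop_nhds_zero_nat u).add_const v
  refine ((h p q).div (h s r) hr).congr' ?_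
  filter_upwards [eventually_gt_atTop 0] with k hk
  have hk' : (k : ℝ) ≠ 0 := by positivity
  rw [Pi.div_apply, div_add' _ _ _ hk', div_add' _ _ _ hk', div_div_div_cancel_right₀ hk']

lemma tendsto_gasperRatio (a b : ℝ) :
    Tendsto (fun k : ℕ ↦ gasperRatio a b k) atTop (𝓝 (1 / 9)) := by
  have h := ((((tendsto_affine_div_affine (3 * a) 1 1 1 one_ne_zero).mul
    (tendsto_affine_div_affine (3 * a + 4) 4 4 (3 * a) four_ne_zero)).mul
    (tendsto_affine_div_affine (3 * b) 1 1 (1 + a - b) one_ne_zero)).mul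
    (tendsto_affine_div_affine (1 - 3 * b) 2 2 (3 * a + 3 * b + 1) two_ne_zero)).mul
    (tendsto_affine_div_affine (2 - 3 * b) 2 2 (3 * a + 3 * b) two_ne_zero) |>.const_mul (1 / 9)
  convert h using 2 with k
  · rw [gasperRatio, div_mul_div_comm, div_mul_div_comm, div_mul_div_comm, div_mul_div_comm,
      div_mul_div_comm]
    congr 1 <;> ring
  · norm_num

lemma summable_gasperTerm (a b : ℝ) : Summable (gasperTerm a b) := by
  refine summable_of_ratio_norm_eventually_le (r := 1 / 2) (by norm_num) ?_
  filter_upwards [(tendsto_gasperRatio a b).norm.eventually_le_const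
    (show ‖(1 / 9 : ℝ)‖ < 1 / 2 by norm_num)] with k hk
  rw [gasperTerm_succ, norm_mul, mul_comm]
  gcongr

lemma tendsto_gasperCert (a b : ℝ) : Tendsto (gasperCert a b) atTop (𝓝 0) := by
  have h := (((tendsto_affine_div_affine 0 1 2 (3 * a + 3 * b) two_ne_zero).mul
    (tendsto_affine_div_affine (2 * a + b) 1 4 (3 * a) four_ne_zero)).const_mul (-9)).mul
    (summable_gasperTerm a b).tendsto_atTop_zero
  rw [mul_zero] at h
  refine h.congr fun k ↦ ?_
  rw [gasperCert, div_mul_div_comm]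
  ring

lemma tsum_gasperTerm_eq_shift {a b : ℝ} (ha : ∀ k : ℕ, 3 * a + k ≠ 0)
    (hab : ∀ k : ℕ, 1 + a - b + k ≠ 0) (hs : ∀ k : ℕ, 3 * a + 3 * b + k ≠ 0) :
    ∑' k, gasperTerm a b k = gasperShift a b * ∑' k, gasperTerm (a + 1) b k := by
  have h1 := summable_gasperTerm a b
  have h2 := (summable_gasperTerm (a + 1) b).mul_left (gasperShift a b)
  rw [← tsum_mul_left, ← sub_eq_zero, ← h1.tsum_sub h2]
  refine tendsto_nhds_unique (h1.sub h2).hasSum.tendsto_sum_nat ?_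
  refine (tendsto_gasperCert a b).congr fun n ↦ ?_
  rw [Finset.sum_congr rfl fun k _ ↦ gasperTerm_sub_shift ha hab hs k, Finset.sum_range_sub]
  simp [gasperCert]

lemma tsum_gasperTerm_eq_prod_shift {a b : ℝ} (ha : ∀ k : ℕ, 3 * a + k ≠ 0)
    (hab : ∀ k : ℕ, 1 + a - b + k ≠ 0) (hs : ∀ k : ℕ, 3 * a + 3 * b + k ≠ 0) (n : ℕ) :
    ∑' k, gasperTerm a b k =
      (∏ j ∈ Finset.range n, gasperShift (a + j) b) * ∑' k, gasperTerm (a + n) b k := by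
  induction n with
  | zero => simp
  | succ n ih =>
    rw [ih, Finset.prod_range_succ, tsum_gasperTerm_eq_shift (a := a + n), mul_assoc,
      Nat.cast_succ, add_assoc a]
    · intro k; convert ha (3 * n + k) using 1; push_cast; ring
    · intro k; convert hab (n + k) using 1; push_cast; ring
    · intro k; convert hs (3 * n + k) using 1; push_cast; ring

lemma tendsto_prod_gasperShift (a b : ℝ)
    (h8 : NotNonposInt (a + 2 * b)) (h9 : NotNonposInt (a + 1 / 3))
    (h10 : NotNonposInt (a + 2 / 3)) (h11 : NotNonposInt (a + 1)) :
    Tendsto (fun n : ℕ ↦ ∏ j ∈ Finset.range (n + 1), gasperShift (a + j) b) atTop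
      (𝓝 ((Real.Gamma (1 + a - b) * Real.Gamma (a + b) * Real.Gamma (a + b + 1 / 3) *
          Real.Gamma (a + b + 2 / 3)) /
        (Real.Gamma (a + 2 * b) * Real.Gamma (a + 1 / 3) * Real.Gamma (a + 2 / 3) *
          Real.Gamma (a + 1)))) := by
  have G := Real.GammaSeq_tendsto_Gamma
  refine (((((G (1 + a - b)).mul (G (a + b))).mul (G (a + b + 1 / 3))).mul
    (G (a + b + 2 / 3))).div ((((G (a + 2 * b)).mul (G (a + 1 / 3))).mul
    (G (a + 2 / 3))).mul (G (a + 1))) ?_).congr' ?_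
  · simp only [mul_ne_zero_iff]
    exact ⟨⟨⟨Real.Gamma_ne_zero h8, Real.Gamma_ne_zero h9⟩, Real.Gamma_ne_zero h10⟩,
      Real.Gamma_ne_zero h11⟩
  filter_upwards [eventually_gt_atTop 0] with n hn
  have hn' : (0 : ℝ) < n := by positivity
  have hpow : (n : ℝ) ^ (1 + a - b) * (n : ℝ) ^ (a + b) * (n : ℝ) ^ (a + b + 1 / 3) *
      (n : ℝ) ^ (a + b + 2 / 3) = (n : ℝ) ^ (a + 2 * b) * (n : ℝ) ^ (a + 1 / 3) *
      (n : ℝ) ^ (a + 2 / 3) * (n : ℝ) ^ (a + 1) := by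
    simp only [← Real.rpow_add hn']
    congr 1
    ring
  have hprod : ∏ j ∈ Finset.range (n + 1), gasperShift (a + j) b =
      ((∏ j ∈ Finset.range (n + 1), (a + 2 * b + j)) *
        (∏ j ∈ Finset.range (n + 1), (a + 1 / 3 + j)) *
        (∏ j ∈ Finset.range (n + 1), (a + 2 / 3 + j)) *
        (∏ j ∈ Finset.range (n + 1), (a + 1 + j))) /
      ((∏ j ∈ Finset.range (n + 1), (1 + a - b + j)) *
        (∏ j ∈ Finset.range (n + 1), (a + b + j)) *
        (∏ j ∈ Finset.range (n + 1), (a + b + 1 / 3 + j)) *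
        (∏ j ∈ Finset.range (n + 1), (a + b + 2 / 3 + j))) := by
    simp only [← Finset.prod_mul_distrib, ← Finset.prod_div_distrib]
    refine Finset.prod_congr rfl fun j _ ↦ ?_
    rw [gasperShift]
    congr 1 <;> ring
  have hne : (n : ℝ) ^ (a + 2 * b) * (n : ℝ) ^ (a + 1 / 3) *
      (n : ℝ) ^ (a + 2 / 3) * (n : ℝ) ^ (a + 1) * (n.factorial : ℝ) ^ 4 ≠ 0 := by positivity
  simp only [Pi.div_apply, Real.GammaSeq, div_mul_div_comm]
  rw [hprod, div_div_div_eq]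
  refine Eq.trans ?_ (mul_div_mul_left _ _ hne)
  congr 1
  · rw [← hpow]
    ring
  · ring

lemma exists_abs_gasperRatio_le (b : ℝ) :
    ∃ A : ℝ, ∀ a ≥ A, (∀ k : ℕ, |gasperRatio a b k| ≤ 1 / 2) ∧
      |gasperRatio a b 0| ≤ |3 * b * (1 - 3 * b) * (2 - 3 * b)| / (3 * a + 3 * b) := by
  set c := |b| with hc
  have hc0 : 0 ≤ c := abs_nonneg b
  refine ⟨4 + 20 * c + 9 * c ^ 2, fun a ha ↦ ?_⟩
  have hb := abs_le.1 hc.ge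
  have hcc : 0 ≤ c ^ 2 := sq_nonneg c
  have hfac (x : ℝ) (hx : 0 ≤ x) :
      |(3 * a + x) * (3 * a + 4 * x + 4)| ≤ 9 / 2 * ((3 * a + 4 * x) * (1 + a - b + x)) := by
    rw [abs_of_nonneg (mul_nonneg (by linarith) (by linarith))]
    calc (3 * a + x) * (3 * a + 4 * x + 4)
        ≤ (27 / 8 * (1 + a - b + x)) * (4 / 3 * (3 * a + 4 * x)) := by
          gcongr <;> linarith
      _ = _ := by ring
  refine ⟨fun k ↦ ?_, ?_⟩
  · have hk : (0 : ℝ) ≤ k := k.cast_nonneg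
    generalize (k : ℝ) = x at *
    have h1 : |(3 * b + x) * (1 - 3 * b + 2 * x)| ≤ (x + 1) * (3 * a + 3 * b + 2 * x + 1) := by
      have hu : |3 * b + x| ≤ 3 * c + x := abs_le.2 ⟨by linarith, by linarith⟩
      have hv : |1 - 3 * b + 2 * x| ≤ 1 + 3 * c + 2 * x := abs_le.2 ⟨by linarith, by linarith⟩
      rw [abs_mul]
      calc _ ≤ (3 * c + x) * (1 + 3 * c + 2 * x) := by gcongr
        _ ≤ (x + 1) * (3 * (4 + 20 * c + 9 * c ^ 2) + 3 * -c + 2 * x + 1) := by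
          nlinarith [mul_nonneg hk hc0, mul_nonneg hk hcc]
        _ ≤ _ := by gcongr; linarith
    have h2 : |2 - 3 * b + 2 * x| ≤ 3 * a + 3 * b + 2 * x :=
      abs_le.2 ⟨by linarith, by linarith⟩
    have hden : 0 < 9 * (x + 1) * (3 * a + 4 * x) * (1 + a - b + x) *
        (3 * a + 3 * b + 2 * x + 1) * (3 * a + 3 * b + 2 * x) := by
      have : 0 < 3 * a + 4 * x := by linarith
      have : 0 < 1 + a - b + x := by linarith
      have : 0 < 3 * a + 3 * b + 2 * x := by linarith
      positivity
    rw [gasperRatio, abs_div, abs_of_pos hden, div_le_iff₀ hden,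
      mul_assoc (_ * _) (3 * b + x), abs_mul, abs_mul]
    calc _ ≤ 9 / 2 * ((3 * a + 4 * x) * (1 + a - b + x)) *
          ((x + 1) * (3 * a + 3 * b + 2 * x + 1)) * (3 * a + 3 * b + 2 * x) :=
          mul_le_mul (mul_le_mul (hfac x hk) h1 (abs_nonneg _) ((abs_nonneg _).trans (hfac x hk)))
            h2 (abs_nonneg _) (mul_nonneg ((abs_nonneg _).trans (hfac x hk))
              ((abs_nonneg _).trans h1))
      _ = _ := by ring
  · have hp : 0 < 3 * a + 3 * b := by linarith
    have hq : 0 < 1 + a - b := by linarith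
    have ha0 : 0 < 3 * a := by linarith
    have h0 := hfac 0 le_rfl
    simp only [gasperRatio, mul_zero, add_zero, zero_add, mul_one] at h0 ⊢
    have hden : 0 < 9 * (3 * a) * (1 + a - b) * (3 * a + 3 * b + 1) * (3 * a + 3 * b) := by
      positivity
    rw [abs_div, abs_of_pos hden, div_le_div_iff₀ hden hp, mul_assoc (_ * _) (3 * b),
      mul_assoc (_ * _) (3 * b * _), abs_mul]
    calc _ ≤ 9 / 2 * (3 * a * (1 + a - b)) * |3 * b * (1 - 3 * b) * (2 - 3 * b)| *
          (3 * a + 3 * b) := by gcongr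
      _ = |3 * b * (1 - 3 * b) * (2 - 3 * b)| *
          (9 * (3 * a) * (1 + a - b) * (1 / 2) * (3 * a + 3 * b)) := by ring
      _ ≤ _ := by gcongr; linarith

lemma tendsto_tsum_gasperTerm (a b : ℝ) :
    Tendsto (fun n : ℕ ↦ ∑' k, gasperTerm (a + n) b k) atTop (𝓝 1) := by
  obtain ⟨A, hA⟩ := exists_abs_gasperRatio_le b
  have hlim : Tendsto (fun n : ℕ ↦ a + (n : ℝ)) atTop atTop :=
    tendsto_atTop_add_const_left _ _ tendsto_natCast_atTop_atTop
  have hden : Tendsto (fun n : ℕ ↦ 3 * (a + (n : ℝ)) + 3 * b) atTop atTop :=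
    tendsto_atTop_add_const_right _ _ (hlim.const_mul_atTop (by norm_num))
  have hbd := (hden.const_div_atTop |3 * b * (1 - 3 * b) * (2 - 3 * b)|).const_mul 2
  rw [mul_zero] at hbd
  rw [tendsto_iff_norm_sub_tendsto_zero]
  refine squeeze_zero' (.of_forall fun _ ↦ norm_nonneg _) ?_ hbd
  filter_upwards [hlim.eventually_ge_atTop A] with n hn
  obtain ⟨hr, h0⟩ := hA _ hn
  generalize a + (n : ℝ) = c at *
  have hgeom (k : ℕ) : ‖gasperTerm c b (k + 1)‖ ≤ |gasperRatio c b 0| * (1 / 2) ^ k := by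
    induction k with
    | zero => simp [gasperTerm_succ, gasperTerm_zero]
    | succ k ih =>
      rw [gasperTerm_succ, norm_mul, pow_succ, ← mul_assoc]
      exact mul_le_mul ih (hr _) (norm_nonneg _) (by positivity)
  rw [(summable_gasperTerm c b).tsum_eq_zero_add, gasperTerm_zero, add_sub_cancel_left]
  calc ‖∑' k, gasperTerm c b (k + 1)‖ ≤ |gasperRatio c b 0| * 2 :=
        tsum_of_norm_bounded (hasSum_geometric_two.mul_left _) hgeom
    _ ≤ _ := by linarith

/-- The limiting case `n → ∞` of Gasper's identity: a `₅F₄` evaluation at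
argument `1/9`. -/
theorem gasper_limit (a b : ℝ)
    (h1 : NotNonposInt (3 * a / 4))
    (h2 : NotNonposInt (1 + a - b))
    (h3 : NotNonposInt ((1 + 3 * a + 3 * b) / 2))
    (h4 : NotNonposInt ((3 * a + 3 * b) / 2))
    (h5 : NotNonposInt (a + b))
    (h6 : NotNonposInt (a + b + 1 / 3))
    (h7 : NotNonposInt (a + b + 2 / 3))
    (h8 : NotNonposInt (a + 2 * b))
    (h9 : NotNonposInt (a + 1 / 3))
    (h10 : NotNonposInt (a + 2 / 3))
    (h11 : NotNonposInt (a + 1)) :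
    ∑' k : ℕ,
        (poch (3 * a) k * poch (1 + 3 * a / 4) k * poch (3 * b) k *
            poch ((1 - 3 * b) / 2) k * poch ((2 - 3 * b) / 2) k) /
          ((k.factorial : ℝ) * poch (3 * a / 4) k * poch (1 + a - b) k *
            poch ((1 + 3 * a + 3 * b) / 2) k * poch ((3 * a + 3 * b) / 2) k) *
          (1 / 9 : ℝ) ^ k =
      (Real.Gamma (1 + a - b) * Real.Gamma (a + b) * Real.Gamma (a + b + 1 / 3) *
          Real.Gamma (a + b + 2 / 3)) /
        (Real.Gamma (a + 2 * b) * Real.Gamma (a + 1 / 3) * Real.Gamma (a + 2 / 3) *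
          Real.Gamma (a + 1)) := by
  have ha (k : ℕ) : 3 * a + k ≠ 0 := fun hk ↦ by
    obtain ⟨m, rfl | rfl | rfl | rfl⟩ :
        ∃ m, k = 0 ∨ k = 3 * m + 1 ∨ k = 3 * m + 2 ∨ k = 3 * m + 3 := ⟨(k - 1) / 3, by omega⟩
    · exact h1 0 (by push_cast at *; linarith)
    · exact h9 m (by push_cast at *; linarith)
    · exact h10 m (by push_cast at *; linarith)
    · exact h11 m (by push_cast at *; linarith)
  have hs (k : ℕ) : 3 * a + 3 * b + k ≠ 0 := fun hk ↦ by
    obtain ⟨m, rfl | rfl⟩ := Nat.even_or_odd' k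
    · exact h4 m (by push_cast at *; linarith)
    · exact h3 m (by push_cast at *; linarith)
  have hab : ∀ k : ℕ, 1 + a - b + k ≠ 0 := fun k hk ↦ h2 k (by linarith)
  have hlim := (tendsto_prod_gasperShift a b h8 h9 h10 h11).mul
    ((tendsto_add_atTop_iff_nat 1).2 (tendsto_tsum_gasperTerm a b))
  rw [mul_one] at hlim
  refine tendsto_nhds_unique tendsto_const_nhds (hlim.congr fun n ↦ ?_)
  exact (tsum_gasperTerm_eq_prod_shift ha hab hs (n + 1)).symm
end

section
/- ∑_{k=0}^∞ (3/2)_k (−1/4)_k (1/4)_k / [(k!)^2 · (k+1)!] · (8k+3)/9^k = 16√3/(3π). -/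
open Filter Topology Finset

/-- The ratio of consecutive terms of `hypTerm j`. -/
noncomputable def termRatio (j i : ℕ) : ℝ :=
  (2 * i + 1) * (6 * j + 4 * i + 1) * (6 * j + 4 * i + 3) / (288 * (i + 1) * (1 + j + i) ^ 2)

/-- The hypergeometric term `(1/2)ₙ (1/2 + 3j)₂ₙ / (n! (1 + j)ₙ² 36ⁿ)`. -/
noncomputable def hypTerm (j n : ℕ) : ℝ := ∏ i ∈ range n, termRatio j i

lemma hypTerm_zero (j : ℕ) : hypTerm j 0 = 1 := by simp [hypTerm]

lemma hypTerm_succ (j n : ℕ) : hypTerm j (n + 1) = hypTerm j n * termRatio j n := by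
  simp [hypTerm, prod_range_succ]

lemma termRatio_nonneg (j i : ℕ) : 0 ≤ termRatio j i := by
  unfold termRatio; positivity

lemma termRatio_le (j i : ℕ) : termRatio j i ≤ 1 / 4 := by
  unfold termRatio
  rw [div_le_iff₀ (by positivity)]
  have hi : (0 : ℝ) ≤ i := i.cast_nonneg
  have hj : (0 : ℝ) ≤ j := j.cast_nonneg
  have h : (6 * j + 4 * i + 1) * (6 * j + 4 * i + 3) ≤ 36 * (1 + j + i : ℝ) ^ 2 := by
    nlinarith [mul_nonneg hi hj, mul_nonneg hi hi]
  calc (2 * i + 1) * (6 * j + 4 * i + 1) * (6 * j + 4 * i + 3)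
      = (2 * i + 1) * ((6 * j + 4 * i + 1) * (6 * j + 4 * i + 3) : ℝ) := by ring
    _ ≤ (2 * i + 2) * (36 * (1 + j + i : ℝ) ^ 2) := by gcongr; norm_num
    _ = 1 / 4 * (288 * (i + 1) * (1 + j + i) ^ 2) := by ring

lemma hypTerm_nonneg (j n : ℕ) : 0 ≤ hypTerm j n :=
  prod_nonneg fun i _ => termRatio_nonneg j i

lemma hypTerm_le (j n : ℕ) : hypTerm j n ≤ (1 / 4) ^ n := by
  simpa [hypTerm] using
    prod_le_prod (s := range n) (fun i _ => termRatio_nonneg j i) fun i _ => termRatio_le j i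

lemma hypTerm_succ_left (j n : ℕ) :
    hypTerm (j + 1) n = hypTerm j n *
      ((6 * j + 4 * n + 1) * (6 * j + 4 * n + 3) * (6 * j + 4 * n + 5) * (1 + j) ^ 2 /
        ((6 * j + 1) * (6 * j + 3) * (6 * j + 5) * (1 + j + n) ^ 2)) := by
  induction n with
  | zero => simp only [hypTerm_zero]; push_cast; field_simp; ring
  | succ n ih =>
    rw [hypTerm_succ, hypTerm_succ, ih]
    unfold termRatio
    push_cast
    field_simp
    ring

lemma summable_pow_mul_hypTerm (j k : ℕ) : Summable fun n : ℕ => (n : ℝ) ^ k * hypTerm j n := by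
  refine Summable.of_nonneg_of_le (fun n => mul_nonneg (by positivity) (hypTerm_nonneg j n))
    (fun n => mul_le_mul_of_nonneg_left (hypTerm_le j n) (by positivity)) ?_
  exact summable_pow_mul_geometric_of_norm_lt_one k (by norm_num)

lemma hasSum_sub_of_summable {G : ℕ → ℝ} (hG : Summable G) (h0 : G 0 = 0) :
    HasSum (fun n => G (n + 1) - G n) 0 := by
  have h := ((hasSum_nat_add_iff' 1).2 hG.hasSum).sub hG.hasSum
  simpa [h0] using h

lemma summable_hypTerm_linear (j : ℕ) :
    Summable fun n : ℕ => hypTerm j n * (8 * n + 6 * j + 1) := by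
  refine (((summable_pow_mul_hypTerm j 1).mul_left 8).add
    ((summable_pow_mul_hypTerm j 0).mul_left (6 * j + 1 : ℝ))).congr fun n => ?_
  ring

/-- The sums `∑ₙ hypTerm j n * (8n + 6j + 1)`. -/
noncomputable def hypSum (j : ℕ) : ℝ := ∑' n : ℕ, hypTerm j n * (8 * n + 6 * j + 1)

lemma hasSum_hypSum (j : ℕ) :
    HasSum (fun n : ℕ => hypTerm j n * (8 * n + 6 * j + 1)) (hypSum j) :=
  (summable_hypTerm_linear j).hasSum

lemma hypSum_succ (j : ℕ) :
    hypSum (j + 1) = 36 * (1 + j) ^ 2 / ((6 * j + 1) * (6 * j + 5)) * hypSum j := by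
  set K : ℝ := 288 * (1 + j) ^ 2 / ((6 * j + 1) * (6 * j + 3) * (6 * j + 5)) with hK
  have hG : Summable fun n : ℕ => hypTerm j n * (n * (K * (1 - 2 * n))) := by
    refine (((summable_pow_mul_hypTerm j 1).mul_left K).sub
      ((summable_pow_mul_hypTerm j 2).mul_left (2 * K))).congr fun n => ?_
    ring
  have h := (hasSum_sub_of_summable hG (by simp)).add ((hasSum_hypSum j).mul_left
    (36 * (1 + j) ^ 2 / ((6 * j + 1) * (6 * j + 5)) : ℝ))
  rw [zero_add] at h
  refine (hasSum_hypSum (j + 1)).unique (h.congr_fun fun n => ?_)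
  rw [hypTerm_succ, hypTerm_succ_left, hK]
  unfold termRatio
  push_cast
  field_simp
  ring

lemma mul_four_sub_one_ne_zero (n : ℕ) : (n * 4 - 1 : ℝ) ≠ 0 := by
  intro h
  have : (n * 4 : ℤ) - 1 = 0 := by exact_mod_cast h
  omega

lemma poch_quotient_eq (n : ℕ) :
    poch (3 / 2) n * poch (-(1 / 4)) n * poch (1 / 4) n /
      ((n.factorial : ℝ) ^ 2 * ((n + 1).factorial : ℝ)) / 9 ^ n =
    hypTerm 0 n * (-(2 * n + 1) / ((4 * n - 1) * (n + 1))) := by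
  induction n with
  | zero => simp [poch, hypTerm]
  | succ n ih =>
    have h1 := mul_four_sub_one_ne_zero n
    have h2 : (4 * (n + 1) - 1 : ℝ) = 4 * n + 3 := by ring
    have hstep : poch (3 / 2) (n + 1) * poch (-(1 / 4)) (n + 1) * poch (1 / 4) (n + 1) /
        (((n + 1).factorial : ℝ) ^ 2 * ((n + 1 + 1).factorial : ℝ)) / 9 ^ (n + 1) =
        poch (3 / 2) n * poch (-(1 / 4)) n * poch (1 / 4) n /
          ((n.factorial : ℝ) ^ 2 * ((n + 1).factorial : ℝ)) / 9 ^ n *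
        ((3 / 2 + n) * (-(1 / 4) + n) * (1 / 4 + n) / (9 * (n + 1) ^ 2 * (n + 2))) := by
      simp only [poch, prod_range_succ, Nat.factorial_succ]
      push_cast
      field_simp
      ring
    rw [hstep, ih, hypTerm_succ]
    unfold termRatio
    push_cast
    rw [h2]
    field_simp
    ring

lemma hasSum_poch_series :
    HasSum (fun k : ℕ => (poch (3/2) k * poch (-(1/4)) k * poch (1/4) k) /
      ((k.factorial : ℝ) ^ 2 * ((k + 1).factorial : ℝ)) * ((8*(k : ℝ) + 3) / (9 : ℝ) ^ k))
      (8 / 3 * hypSum 0) := by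
  have hG : Summable fun n : ℕ => hypTerm 0 n * (96 * n ^ 2 / (4 * n - 1)) := by
    refine Summable.of_norm_bounded ((summable_pow_mul_hypTerm 0 2).mul_left 96) fun n => ?_
    rw [Real.norm_eq_abs, abs_mul, abs_of_nonneg (hypTerm_nonneg 0 n), abs_div,
      abs_of_nonneg (by positivity : (0 : ℝ) ≤ 96 * (n : ℝ) ^ 2)]
    have h : (1 : ℝ) ≤ |4 * (n : ℝ) - 1| := by
      rcases Nat.eq_zero_or_pos n with rfl | hn
      · norm_num
      · have : (1 : ℝ) ≤ n := by exact_mod_cast hn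
        rw [le_abs]
        left
        linarith
    have := div_le_self (by positivity : (0 : ℝ) ≤ 96 * (n : ℝ) ^ 2) h
    calc hypTerm 0 n * (96 * n ^ 2 / |4 * (n : ℝ) - 1|) ≤ hypTerm 0 n * (96 * n ^ 2) :=
          mul_le_mul_of_nonneg_left this (hypTerm_nonneg 0 n)
      _ = 96 * (n ^ 2 * hypTerm 0 n) := by ring
  have h := (hasSum_sub_of_summable hG (by simp)).add ((hasSum_hypSum 0).mul_left (8 / 3))
  rw [zero_add] at h
  refine h.congr_fun fun n => ?_
  have h1 := mul_four_sub_one_ne_zero n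
  have h2 : (4 * (n + 1) - 1 : ℝ) = 4 * n + 3 := by ring
  rw [mul_div_assoc', mul_div_right_comm, poch_quotient_eq, hypTerm_succ]
  unfold termRatio
  push_cast
  rw [h2]
  field_simp
  ring

/-- The limit of `hypTerm j n` as `j → ∞`. -/
noncomputable def limTerm (n : ℕ) : ℝ := Ring.choose (-(1 / 2) : ℝ) n * (-(1 / 4)) ^ n

lemma limTerm_succ (n : ℕ) : limTerm (n + 1) = limTerm n * ((2 * n + 1) / (8 * (n + 1))) := by
  have h := Ring.choose_smul_choose (-(1 / 2) : ℝ) (Nat.le_succ n)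
  simp only [Nat.succ_eq_add_one, Nat.choose_succ_self_right, nsmul_eq_mul,
    Nat.add_sub_cancel_left, Ring.choose_one_right] at h
  push_cast at h
  have h' : Ring.choose (-(1 / 2) : ℝ) (n + 1) =
      Ring.choose (-(1 / 2) : ℝ) n * (-(1 / 2) - n) / (n + 1) := by
    rw [eq_div_iff (by positivity), ← h]
    ring
  rw [limTerm, limTerm, h', pow_succ]
  field_simp
  ring

lemma tsum_limTerm : ∑' n, limTerm n = 2 / √3 := by
  have h := (Real.one_add_rpow_hasFPowerSeriesOnBall_zero (a := -(1 / 2))).hasSum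
    (y := -(1 / 4)) (by simp [enorm_eq_nnnorm])
  have h' : HasSum limTerm ((1 + (0 + -(1 / 4)) : ℝ) ^ (-(1 / 2) : ℝ)) :=
    h.congr_fun fun n => by
      rw [binomialSeries_apply, limTerm]; simp
  rw [h'.tsum_eq, Real.rpow_neg (by norm_num), ← Real.sqrt_eq_rpow,
    show (1 + (0 + -(1 / 4)) : ℝ) = 3 / 2 ^ 2 by norm_num, Real.sqrt_div (by norm_num),
    Real.sqrt_sq (by norm_num), inv_div]

lemma tendsto_termRatio (i : ℕ) :
    Tendsto (fun j => termRatio j i) atTop (𝓝 ((2 * i + 1) / (8 * (i + 1)))) := by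
  have h (c : ℝ) : Tendsto (fun j : ℕ => (6 * j + c) / (1 + i + j : ℝ)) atTop (𝓝 6) := by
    simpa [add_comm] using
      tendsto_add_mul_div_add_mul_atTop_nhds c (1 + i : ℝ) 6 one_ne_zero
  convert ((h (4 * i + 1)).mul (h (4 * i + 3))).const_mul
    ((2 * i + 1 : ℝ) / (288 * (i + 1))) using 1
  · ext j
    unfold termRatio
    field_simp
    ring
  · congr 1
    field_simp
    norm_num

lemma tendsto_hypTerm (n : ℕ) : Tendsto (fun j => hypTerm j n) atTop (𝓝 (limTerm n)) := by
  induction n with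
  | zero => simp [hypTerm, limTerm]
  | succ n ih =>
    simp only [hypTerm_succ, limTerm_succ]
    exact ih.mul (tendsto_termRatio n)

lemma tendsto_hypSum_div : Tendsto (fun j => hypSum j / (j + 1)) atTop (𝓝 (12 / √3)) := by
  have hlin (n : ℕ) : Tendsto (fun j : ℕ => (8 * n + 6 * j + 1) / (j + 1 : ℝ)) atTop (𝓝 6) := by
    simpa [add_comm, add_assoc, add_left_comm] using
      tendsto_add_mul_div_add_mul_atTop_nhds (8 * n + 1 : ℝ) 1 6 one_ne_zero
  have hbound : Summable fun n : ℕ => (1 / 4 : ℝ) ^ n * (8 * n + 6) := by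
    have h := ((summable_pow_mul_geometric_of_norm_lt_one (R := ℝ) 1
      (by norm_num : ‖(1 / 4 : ℝ)‖ < 1)).mul_left 8).add
      ((summable_geometric_of_norm_lt_one (by norm_num : ‖(1 / 4 : ℝ)‖ < 1)).mul_left 6)
    exact h.congr fun n => by ring
  have h := tendsto_tsum_of_dominated_convergence hbound
    (f := fun j n => hypTerm j n * ((8 * n + 6 * j + 1) / (j + 1 : ℝ)))
    (fun n => (tendsto_hypTerm n).mul (hlin n)) <| Eventually.of_forall fun j n => by
      rw [Real.norm_of_nonneg (mul_nonneg (hypTerm_nonneg j n) (by positivity))]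
      refine mul_le_mul (hypTerm_le j n) ?_ (by positivity) (by positivity)
      rw [div_le_iff₀ (by positivity)]
      nlinarith [mul_nonneg (n.cast_nonneg : (0 : ℝ) ≤ n) (j.cast_nonneg : (0 : ℝ) ≤ j)]
  rw [tsum_mul_right, tsum_limTerm] at h
  convert h using 1
  · ext j
    rw [hypSum, ← tsum_div_const]
    simp only [mul_div_assoc]
  · congr 1
    ring

lemma prod_mul_hypSum (n : ℕ) :
    hypSum n * ((∏ i ∈ range n, (1 / 6 + i : ℝ)) * ∏ i ∈ range n, (5 / 6 + i : ℝ)) =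
      hypSum 0 * (n.factorial : ℝ) ^ 2 := by
  induction n with
  | zero => simp
  | succ n ih =>
    rw [hypSum_succ, prod_range_succ, prod_range_succ, Nat.factorial_succ]
    push_cast
    rw [mul_pow, mul_left_comm (hypSum 0), ← ih]
    field_simp
    ring

lemma hypSum_zero : hypSum 0 = 2 * √3 / Real.pi := by
  have hΓ : Real.Gamma (1 / 6) * Real.Gamma (5 / 6) = 2 * Real.pi := by
    have h := Real.Gamma_mul_Gamma_one_sub (1 / 6)
    rw [mul_one_div, Real.sin_pi_div_six, show (1 - 1 / 6 : ℝ) = 5 / 6 by norm_num] at h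
    rw [h]
    ring
  have h1 := ((Real.GammaSeq_tendsto_Gamma (1 / 6)).mul
    (Real.GammaSeq_tendsto_Gamma (5 / 6))).const_mul (hypSum 0)
  rw [hΓ] at h1
  have h2 := (((tendsto_add_atTop_iff_nat 1).2 tendsto_hypSum_div).mul
    (tendsto_add_mul_div_add_mul_atTop_nhds (0 : ℝ) 1 1 one_ne_zero)).mul
    (tendsto_add_mul_div_add_mul_atTop_nhds (2 : ℝ) 1 1 one_ne_zero)
  have h := tendsto_nhds_unique h1 (h2.congr fun n => ?_)
  · have h3 : √3 * √3 = 3 := Real.mul_self_sqrt (by norm_num)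
    have h4 : √3 ≠ 0 := by positivity
    rw [eq_div_iff Real.pi_ne_zero]
    field_simp at h
    have h5 : √3 * (hypSum 0 * Real.pi - 2 * √3) = 0 := by linarith
    exact sub_eq_zero.1 ((mul_eq_zero.1 h5).resolve_left h4)
  · have hA : (∏ i ∈ range (n + 1), (1 / 6 + i : ℝ)) ≠ 0 := by positivity
    have hB : (∏ i ∈ range (n + 1), (5 / 6 + i : ℝ)) ≠ 0 := by positivity
    have hpow : (n : ℝ) ^ (1 / 6 : ℝ) * (n : ℝ) ^ (5 / 6 : ℝ) = n := by
      rw [← Real.rpow_add_of_nonneg n.cast_nonneg (by norm_num) (by norm_num)]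
      norm_num
    have hprod := prod_mul_hypSum (n + 1)
    rw [Nat.factorial_succ] at hprod
    push_cast at hprod
    have hS : hypSum (n + 1) = hypSum 0 * ((n + 1) * n.factorial) ^ 2 /
        ((∏ i ∈ range (n + 1), (1 / 6 + i : ℝ)) * ∏ i ∈ range (n + 1), (5 / 6 + i : ℝ)) := by
      rw [eq_div_iff (mul_ne_zero hA hB), hprod]
    rw [Real.GammaSeq, Real.GammaSeq, div_mul_div_comm (_ * (n.factorial : ℝ)),
      mul_mul_mul_comm ((n : ℝ) ^ (1 / 6 : ℝ)), hpow, hS]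
    push_cast
    field_simp
    ring

theorem example_thm6_p0q0 :
    ∑' k : ℕ, (poch (3/2) k * poch (-(1/4)) k * poch (1/4) k) / ((k.factorial : ℝ) ^ 2 * ((k + 1).factorial : ℝ)) * ((8*(k : ℝ) + 3) / (9 : ℝ) ^ k) = 16 * Real.sqrt 3 / (3 * Real.pi) := by
  rw [hasSum_poch_series.tsum_eq, hypSum_zero]
  field_simp
  norm_num
end

section
/- ∑_{k=0}^∞ (5/2)_k (−3/4)_k (−1/4)_k / [(k!)^2 · (k+2)!] · (8k+5)/9^k = 128√3/(27π). -/
open Filter Topology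

/-- The ratio of consecutive terms, without its linear factor, of the series `∑ quarticTerm a k`. -/
noncomputable def quarticRatio (a : ℝ) (i : ℕ) : ℝ :=
  (a + i) * (i + 5/2) * ((2*i - 3/2) * (2*i - 1/2)) /
    (3 * (i + 1) * (3*i + a + 1/2) * (a + 5/2 + 2*i) * (a + 7/2 + 2*i))

noncomputable def quarticProd (a : ℝ) (k : ℕ) : ℝ :=
  ∏ i ∈ Finset.range k, quarticRatio a i

/-- The general term of a very-well-poised series with argument `1/9` and free parameter `a`. -/
noncomputable def quarticTerm (a : ℝ) (k : ℕ) : ℝ :=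
  (a + 4*k) * quarticProd a k

/-- The companion of `quarticTerm` in the telescoping relation for the shift `a ↦ a + 3`. -/
noncomputable def quarticCert (a : ℝ) (k : ℕ) : ℝ :=
  k * (9*k + 6*a + 15/2) / (a + 5/2 + 2*k) * quarticProd a k

/-- The factor by which the sum of the series grows under `a ↦ a + 3`. -/
noncomputable def quarticShift (a : ℝ) : ℝ :=
  ((a + 5/2) * (a + 7/2) * (a + 9/2) * (a + 1/2)) / (a * (a + 1) * (a + 2) * (a + 5))

theorem quarticProd_succ (a : ℝ) (k : ℕ) :
    quarticProd a (k + 1) = quarticProd a k * quarticRatio a k :=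
  Finset.prod_range_succ _ _

theorem quarticProd_add_three {a : ℝ} (ha : 0 < a) (k : ℕ) :
    quarticProd (a + 3) k = quarticProd a k *
      (((a + k) * (a + k + 1) * (a + k + 2)) / (a * (a + 1) * (a + 2)) *
        ((a + 1/2) / (a + 1/2 + 3*k)) *
        (((a + 5/2) * (a + 7/2) * (a + 9/2)) /
          ((a + 5/2 + 2*k) * (a + 7/2 + 2*k) * (a + 9/2 + 2*k)))) := by
  induction k with
  | zero =>
    simp only [quarticProd, Finset.range_zero, Finset.prod_empty, Nat.cast_zero]
    field_simp
    simp
  | succ k ih =>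
    rw [quarticProd_succ, quarticProd_succ, ih, mul_assoc (quarticProd a k),
      mul_assoc (quarticProd a k)]
    congr 1
    have hk : (0 : ℝ) ≤ k := Nat.cast_nonneg k
    simp only [quarticRatio]
    push_cast
    have h1 : a + 1/2 + 3*(k:ℝ) ≠ 0 := by positivity
    have h2 : a + 5/2 + 2*(k:ℝ) ≠ 0 := by positivity
    have h3 : a + 7/2 + 2*(k:ℝ) ≠ 0 := by positivity
    have h4 : a + 9/2 + 2*(k:ℝ) ≠ 0 := by positivity
    have e1 : 3*(k:ℝ) + (a+3) + 1/2 = a + 1/2 + 3*(k+1) := by ring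
    have e2 : a + 3 + 5/2 + 2*(k:ℝ) = a + 7/2 + 2*(k+1) := by ring
    have e3 : a + 3 + 7/2 + 2*(k:ℝ) = a + 9/2 + 2*(k+1) := by ring
    have e4 : 3*(k:ℝ) + a + 1/2 = a + 1/2 + 3*k := by ring
    have e5 : a + 9/2 + 2*(k:ℝ) = a + 5/2 + 2*(k+1) := by ring
    rw [e1, e2, e3, e4, e5]
    have h5 : a + 1/2 + 3*((k:ℝ)+1) ≠ 0 := by positivity
    have h6 : a + 5/2 + 2*((k:ℝ)+1) ≠ 0 := by positivity
    have h7 : a + 7/2 + 2*((k:ℝ)+1) ≠ 0 := by positivity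
    have h8 : a + 9/2 + 2*((k:ℝ)+1) ≠ 0 := by positivity
    field_simp
    ring

theorem quarticTerm_add_three {a : ℝ} (ha : 0 < a) (k : ℕ) :
    quarticTerm (a + 3) k = quarticShift a * quarticTerm a k +
      quarticShift a * (quarticCert a (k + 1) - quarticCert a k) := by
  have hk : (0 : ℝ) ≤ k := Nat.cast_nonneg k
  rw [quarticTerm, quarticProd_add_three ha, quarticTerm, quarticCert, quarticCert,
    quarticProd_succ, quarticShift, quarticRatio]
  push_cast
  have e4 : 3*(k:ℝ) + a + 1/2 = a + 1/2 + 3*k := by ring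
  have e5 : a + 9/2 + 2*(k:ℝ) = a + 5/2 + 2*(k+1) := by ring
  rw [e4, e5]
  have h1 : a + 1/2 + 3*(k:ℝ) ≠ 0 := by positivity
  have h2 : a + 5/2 + 2*(k:ℝ) ≠ 0 := by positivity
  have h3 : a + 7/2 + 2*(k:ℝ) ≠ 0 := by positivity
  have h6 : a + 5/2 + 2*((k:ℝ)+1) ≠ 0 := by positivity
  field_simp
  ring

theorem abs_quarticRatio_le {a : ℝ} (ha : 5/2 ≤ a) (i : ℕ) :
    |quarticRatio a i| ≤ 4/9 * ((i + 5/2) / (a + 7/2 + 2*i)) := by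
  have hi : (0 : ℝ) ≤ i := Nat.cast_nonneg i
  have h1 : |(2*(i:ℝ) - 3/2) * (2*i - 1/2)| ≤ 4 * (i + 1)^2 := by
    rw [abs_le]
    constructor <;> nlinarith
  have hden : 0 < 3 * ((i:ℝ) + 1) * (3*i + a + 1/2) * (a + 5/2 + 2*i) * (a + 7/2 + 2*i) := by
    positivity
  rw [quarticRatio, abs_div, abs_of_pos hden, abs_mul,
    abs_of_nonneg (by positivity : 0 ≤ (a + i) * ((i:ℝ) + 5/2))]
  have h5 : |(2*(i:ℝ) - 3/2) * (2*i - 1/2)| ≤ 4 * ((i + 1) * ((3*i + a + 1/2) / 3)) := by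
    refine h1.trans ?_
    rw [pow_two]
    gcongr
    linarith
  have h6 : a + i ≤ a + 5/2 + 2*i := by linarith
  calc _ ≤ (a + 5/2 + 2*i) * ((i:ℝ) + 5/2) * (4 * ((i + 1) * ((3*i + a + 1/2) / 3))) /
        (3 * ((i:ℝ) + 1) * (3*i + a + 1/2) * (a + 5/2 + 2*i) * (a + 7/2 + 2*i)) := by
        gcongr ?_ / _
        exact mul_le_mul (mul_le_mul_of_nonneg_right h6 (by positivity)) h5 (abs_nonneg _)
          (by positivity)
    _ = _ := by
        have h2 : 3*(i:ℝ) + a + 1/2 ≠ 0 := by positivity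
        have h3 : a + 5/2 + 2*(i:ℝ) ≠ 0 := by positivity
        have h4 : a + 7/2 + 2*(i:ℝ) ≠ 0 := by positivity
        field_simp
        norm_num

theorem abs_quarticProd_le {a : ℝ} (ha : 5/2 ≤ a) (k : ℕ) :
    |quarticProd a k| ≤ (2/9)^k := by
  rw [quarticProd, Finset.abs_prod]
  refine (Finset.prod_le_prod (g := fun _ => 2/9) (fun i _ => abs_nonneg _)
    fun i _ => ?_).trans_eq (by rw [Finset.prod_const, Finset.card_range])
  have hi : (0 : ℝ) ≤ i := Nat.cast_nonneg i
  have : ((i:ℝ) + 5/2) / (a + 7/2 + 2*i) ≤ 1/2 := by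
    rw [div_le_iff₀ (by positivity)]
    linarith
  linarith [abs_quarticRatio_le ha i]

theorem abs_quarticTerm_le {a : ℝ} (ha : 5/2 ≤ a) (k : ℕ) :
    |quarticTerm a k| ≤ a * ((1 + 4*k) * (2/9)^k) := by
  have hk : (0 : ℝ) ≤ k := Nat.cast_nonneg k
  rw [quarticTerm, abs_mul, abs_of_nonneg (by positivity), ← mul_assoc]
  gcongr
  · nlinarith
  · exact abs_quarticProd_le ha k

theorem summable_one_add_mul_geometric :
    Summable fun k : ℕ => (1 + 4*(k:ℝ)) * (2/9)^k := by
  have h0 := summable_geometric_of_lt_one (r := (2/9 : ℝ)) (by norm_num) (by norm_num)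
  have h1 := summable_pow_mul_geometric_of_norm_lt_one 1 (r := (2/9 : ℝ)) (by norm_num)
  refine (h0.add (h1.mul_left 4)).congr fun k => ?_
  ring

theorem summable_quarticTerm {a : ℝ} (ha : 5/2 ≤ a) : Summable (quarticTerm a) :=
  (summable_one_add_mul_geometric.mul_left a).of_norm_bounded (abs_quarticTerm_le ha)

theorem tendsto_quarticCert {a : ℝ} (ha : 5/2 ≤ a) :
    Tendsto (quarticCert a) atTop (𝓝 0) := by
  have h := (summable_pow_mul_geometric_of_norm_lt_one 1
    (r := (2/9 : ℝ)) (by norm_num)).tendsto_atTop_zero.const_mul 9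
  rw [mul_zero] at h
  refine squeeze_zero_norm (fun k => ?_) h
  have hk : (0 : ℝ) ≤ k := Nat.cast_nonneg k
  rw [Real.norm_eq_abs, quarticCert, abs_mul, abs_of_nonneg (by positivity), pow_one, ← mul_assoc]
  gcongr
  · rw [div_le_iff₀ (by positivity)]
    nlinarith
  · exact abs_quarticProd_le ha k

theorem tsum_quarticTerm_add_three {a : ℝ} (ha : 5/2 ≤ a) :
    ∑' k, quarticTerm (a + 3) k = quarticShift a * ∑' k, quarticTerm a k := by
  have h1 := (summable_quarticTerm (a := a + 3) (by linarith)).hasSum.tendsto_sum_nat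
  have h2 := ((summable_quarticTerm ha).hasSum.tendsto_sum_nat.const_mul (quarticShift a)).add
    ((tendsto_quarticCert ha).const_mul (quarticShift a))
  rw [mul_zero, add_zero] at h2
  refine tendsto_nhds_unique h1 (h2.congr fun n => ?_)
  have h0 : quarticCert a 0 = 0 := by simp [quarticCert]
  rw [Finset.sum_congr rfl fun k _ => quarticTerm_add_three (by linarith : 0 < a) k,
    Finset.sum_add_distrib, ← Finset.mul_sum, ← Finset.mul_sum, Finset.sum_range_sub, h0, sub_zero]

theorem tendsto_tsum_quarticTerm_div :
    Tendsto (fun a : ℝ => (∑' k, quarticTerm a k) / a) atTop (𝓝 1) := by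
  have key : Tendsto (fun a : ℝ => ∑' k, quarticTerm a k / a) atTop
      (𝓝 (∑' k : ℕ, if k = 0 then (1:ℝ) else 0)) := by
    refine tendsto_tsum_of_dominated_convergence summable_one_add_mul_geometric (fun k => ?_) ?_
    · rcases k with _ | k
      · refine tendsto_const_nhds.congr' ?_
        filter_upwards [eventually_gt_atTop 0] with a ha
        simp [quarticTerm, quarticProd, ha.ne']
      · have hlim : Tendsto (fun a : ℝ => (5 + 4*(k:ℝ)) * (4/9 * (((k:ℝ) + 5/2) / a)))
            atTop (𝓝 0) := by
          have := ((tendsto_const_nhds (x := (k:ℝ) + 5/2)).div_atTop tendsto_id).const_mul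
            ((5 + 4*(k:ℝ)) * (4/9))
          simpa [mul_assoc] using this
        refine squeeze_zero_norm' ?_ hlim
        filter_upwards [eventually_ge_atTop (5/2)] with a ha
        have hk : (0 : ℝ) ≤ k := Nat.cast_nonneg k
        have ha0 : 0 < a := by linarith
        rw [Real.norm_eq_abs, quarticTerm, mul_div_right_comm, abs_mul,
          abs_of_nonneg (by positivity), quarticProd_succ, abs_mul]
        refine mul_le_mul ?_ ?_ (by positivity) (by positivity)
        · rw [div_le_iff₀ ha0]
          push_cast
          nlinarith
        · calc _ ≤ 1 * (4/9 * (((k:ℝ) + 5/2) / (a + 7/2 + 2*k))) := by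
                refine mul_le_mul ?_ (abs_quarticRatio_le ha k) (abs_nonneg _) zero_le_one
                exact (abs_quarticProd_le ha k).trans (pow_le_one₀ (by norm_num) (by norm_num))
            _ ≤ _ := by
                rw [one_mul]
                gcongr
                linarith
    · filter_upwards [eventually_ge_atTop (5/2)] with a ha k
      have ha0 : 0 < a := by linarith
      rw [Real.norm_eq_abs, abs_div, abs_of_pos ha0, div_le_iff₀ ha0, mul_comm]
      exact abs_quarticTerm_le ha k
  simpa [tsum_div_const, tsum_ite_eq] using key

theorem tendsto_Gamma_add_half_div :
    Tendsto (fun x : ℝ => Real.Gamma (x + 1/2) / (Real.Gamma x * √x)) atTop (𝓝 1) := by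
  have hconv : ∀ x : ℝ, 0 < x → Real.Gamma (x + 1/2) ≤ Real.Gamma x * √x := by
    intro x hx
    have hG := Real.Gamma_pos_of_pos hx
    have h := Real.Gamma_mul_add_mul_le_rpow_Gamma_mul_rpow_Gamma hx
      (by linarith : 0 < x + 1) (by norm_num : (0:ℝ) < 1/2) (by norm_num : (0:ℝ) < 1/2)
      (by norm_num)
    rw [Real.Gamma_add_one hx.ne', ← Real.sqrt_eq_rpow, ← Real.sqrt_eq_rpow,
      Real.sqrt_mul hx.le] at h
    have hs := Real.mul_self_sqrt hG.le
    calc _ = Real.Gamma (1/2 * x + 1/2 * (x + 1)) := by ring_nf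
      _ ≤ _ := h
      _ = (√(Real.Gamma x) * √(Real.Gamma x)) * √x := by ring
      _ = _ := by rw [hs]
  have hlow : Tendsto (fun x : ℝ => √(x / (x + 1/2))) atTop (𝓝 1) := by
    have h1 : Tendsto (fun x : ℝ => 1 - (1/2) / (x + 1/2)) atTop (𝓝 (1 - 0)) :=
      tendsto_const_nhds.sub (tendsto_const_nhds.div_atTop
        (tendsto_atTop_add_const_right _ _ tendsto_id))
    have h2 := h1.sqrt
    rw [sub_zero, Real.sqrt_one] at h2
    refine h2.congr' ?_
    filter_upwards [eventually_gt_atTop 0] with x hx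
    congr 1
    field_simp
    ring
  refine tendsto_of_tendsto_of_tendsto_of_le_of_le' hlow tendsto_const_nhds ?_ ?_
  · filter_upwards [eventually_gt_atTop 0] with x hx
    have hG := Real.Gamma_pos_of_pos hx
    have h := hconv (x + 1/2) (by linarith)
    rw [show x + 1/2 + 1/2 = x + 1 by ring, Real.Gamma_add_one hx.ne'] at h
    rw [Real.sqrt_div hx.le, div_le_div_iff₀ (by positivity) (by positivity)]
    calc _ = (√x * √x) * Real.Gamma x := by ring
      _ = x * Real.Gamma x := by rw [Real.mul_self_sqrt hx.le]
      _ ≤ _ := h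
  · filter_upwards [eventually_gt_atTop 0] with x hx
    have hG := Real.Gamma_pos_of_pos hx
    rw [div_le_one (by positivity)]
    exact hconv x hx

/-- The closed form of `∑ quarticTerm a k`, for `a = 3 m + 5/2`. -/
noncomputable def quarticSum (m : ℝ) : ℝ :=
  Real.Gamma (3*m + 5) * Real.Gamma (m + 1) /
    (3 * √3 * (Real.Gamma (3*m + 5/2) * Real.Gamma (m + 5/2)))

theorem quarticSum_pos {m : ℝ} (hm : 0 ≤ m) : 0 < quarticSum m := by
  have h1 := Real.Gamma_pos_of_pos (by positivity : 0 < 3*m + 5)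
  have h2 := Real.Gamma_pos_of_pos (by positivity : 0 < m + 1)
  have h3 := Real.Gamma_pos_of_pos (by positivity : 0 < 3*m + 5/2)
  have h4 := Real.Gamma_pos_of_pos (by positivity : 0 < m + 5/2)
  rw [quarticSum]
  positivity

theorem Gamma_add_three {x : ℝ} (hx : 0 < x) :
    Real.Gamma (x + 3) = (x + 2) * ((x + 1) * (x * Real.Gamma x)) := by
  rw [show x + 3 = x + 2 + 1 by ring, Real.Gamma_add_one (by positivity),
    show x + 2 = x + 1 + 1 by ring, Real.Gamma_add_one (by positivity),
    Real.Gamma_add_one (by positivity)]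

theorem quarticSum_add_one {m : ℝ} (hm : 0 ≤ m) :
    quarticSum (m + 1) = quarticShift (3*m + 5/2) * quarticSum m := by
  have h3 := Real.Gamma_pos_of_pos (by positivity : 0 < 3*m + 5/2)
  have h4 := Real.Gamma_pos_of_pos (by positivity : 0 < m + 5/2)
  rw [quarticSum, quarticSum, quarticShift, show 3*(m+1) + 5 = 3*m + 5 + 3 by ring,
    show 3*(m+1) + 5/2 = 3*m + 5/2 + 3 by ring, show m + 1 + 5/2 = m + 5/2 + 1 by ring,
    Gamma_add_three (by positivity), Gamma_add_three (by positivity),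
    Real.Gamma_add_one (by positivity : m + 1 ≠ 0),
    Real.Gamma_add_one (by positivity : m + 5/2 ≠ 0)]
  have h5 : 3*m + 5/2 + 5 ≠ 0 := by positivity
  have h6 : m + 5/2 ≠ 0 := by positivity
  have h7 : 3*m + 5/2 ≠ 0 := by positivity
  have h8 : 3*m + 5/2 + 5 = 3*(m + 5/2) := by ring
  rw [h8]
  field_simp
  ring

theorem tendsto_quarticSum_div :
    Tendsto (fun m : ℝ => quarticSum m / (3*m + 5/2)) atTop (𝓝 1) := by
  have hm3 : Tendsto (fun m : ℝ => 3*m + 9/2) atTop atTop :=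
    tendsto_atTop_add_const_right _ _ (tendsto_id.const_mul_atTop (by norm_num))
  have hm1 : Tendsto (fun m : ℝ => m + 1) atTop atTop :=
    tendsto_atTop_add_const_right _ _ tendsto_id
  have hm2 : Tendsto (fun m : ℝ => m + 3/2) atTop atTop :=
    tendsto_atTop_add_const_right _ _ tendsto_id
  have hG := (tendsto_Gamma_add_half_div.comp hm3).div (tendsto_Gamma_add_half_div.comp hm1)
    one_ne_zero
  have hq : Tendsto (fun m : ℝ => 3 - 1 / (m + 3/2)) atTop (𝓝 (3 - 0)) :=
    tendsto_const_nhds.sub (tendsto_const_nhds.div_atTop hm2)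
  have hs : Tendsto (fun m : ℝ => √(3 + (3/2) / (m + 1))) atTop (𝓝 (√(3 + 0))) :=
    (tendsto_const_nhds.add (tendsto_const_nhds.div_atTop hm1)).sqrt
  have h := ((hq.mul hs).mul hG).div_const (3 * √3)
  have hone : (3 - 0) * √(3 + 0) * (1 / 1) / (3 * √3) = (1 : ℝ) := by
    rw [sub_zero, add_zero]
    field_simp
  rw [hone] at h
  refine h.congr' ?_
  filter_upwards [eventually_gt_atTop 0] with m hm
  have g1 := Real.Gamma_pos_of_pos (by positivity : 0 < m + 1)
  have g2 := Real.Gamma_pos_of_pos (by positivity : 0 < m + 3/2)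
  have g3 := Real.Gamma_pos_of_pos (by positivity : 0 < 3*m + 5/2)
  have e1 : Real.Gamma (3*m + 9/2) = (3*m + 7/2) * ((3*m + 5/2) * Real.Gamma (3*m + 5/2)) := by
    rw [show 3*m + 9/2 = 3*m + 5/2 + 1 + 1 by ring, Real.Gamma_add_one (by positivity),
      Real.Gamma_add_one (by positivity)]
    ring
  have e2 : Real.Gamma (m + 5/2) = (m + 3/2) * Real.Gamma (m + 3/2) := by
    rw [show m + 5/2 = m + 3/2 + 1 by ring, Real.Gamma_add_one (by positivity)]
  have e3 : √(3 + (3/2) / (m + 1)) = √(3*m + 9/2) / √(m + 1) := by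
    rw [← Real.sqrt_div (by positivity)]
    congr 1
    field_simp
    ring
  simp only [Function.comp_apply, Pi.div_apply]
  rw [quarticSum, e3, e1, e2, show 3*m + 9/2 + 1/2 = 3*m + 5 by ring,
    show m + 1 + 1/2 = m + 3/2 by ring]
  have p1 : 0 < √(3*m + 9/2) := by positivity
  have p2 : 0 < √(m + 1) := by positivity
  have p3 : 3*m + 5/2 ≠ 0 := by positivity
  have p4 : 3*m + 7/2 ≠ 0 := by positivity
  have p5 : m + 3/2 ≠ 0 := by positivity
  have p6 : 3 - 1 / (m + 3/2) = (3*m + 7/2) / (m + 3/2) := by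
    field_simp
    ring
  rw [p6]
  generalize √(3*m + 9/2) = u at *
  generalize √(m + 1) = v at *
  field_simp

theorem tsum_quarticTerm_eq : ∑' k, quarticTerm (5/2) k = quarticSum 0 := by
  have hrec : ∀ m : ℕ, (∑' k, quarticTerm (3*(m:ℝ) + 5/2) k) / quarticSum m =
      (∑' k, quarticTerm (5/2) k) / quarticSum 0 := by
    intro m
    induction m with
    | zero => simp
    | succ m ih =>
      have hm : (0 : ℝ) ≤ m := Nat.cast_nonneg m
      have hne : quarticShift (3*(m:ℝ) + 5/2) ≠ 0 := by
        rw [quarticShift]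
        positivity
      rw [← ih]
      push_cast
      rw [quarticSum_add_one hm, show 3*((m:ℝ) + 1) + 5/2 = 3*m + 5/2 + 3 by ring,
        tsum_quarticTerm_add_three (by linarith), mul_div_mul_left _ _ hne]
  have hcast := tendsto_natCast_atTop_atTop (R := ℝ)
  have ha : Tendsto (fun m : ℝ => 3*m + 5/2) atTop atTop :=
    tendsto_atTop_add_const_right _ _ (tendsto_id.const_mul_atTop (by norm_num))
  have h := ((tendsto_tsum_quarticTerm_div.comp ha).div tendsto_quarticSum_div
    one_ne_zero).comp hcast
  rw [div_one] at h
  have hconst : (∑' k, quarticTerm (5/2) k) / quarticSum 0 = 1 := by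
    refine tendsto_nhds_unique (tendsto_const_nhds.congr fun m => ?_) h
    have hm : (3*(m:ℝ) + 5/2) ≠ 0 := by positivity
    rw [← hrec m]
    simp only [Function.comp_apply, Pi.div_apply]
    rw [div_div_div_cancel_right₀ hm]
  exact (div_eq_one_iff_eq (quarticSum_pos le_rfl).ne').mp hconst

theorem quarticSum_zero : quarticSum 0 = 128 * √3 / (27 * Real.pi) := by
  have h5 : Real.Gamma 5 = 24 := by
    rw [show (5:ℝ) = ((4:ℕ):ℝ) + 1 by norm_num, Real.Gamma_nat_eq_factorial]
    norm_num [Nat.factorial]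
  have h52 : Real.Gamma (5/2) = 3/4 * √Real.pi := by
    rw [show (5/2:ℝ) = 1/2 + 1 + 1 by norm_num, Real.Gamma_add_one (by norm_num),
      Real.Gamma_add_one (by norm_num), Real.Gamma_one_half_eq]
    ring
  rw [quarticSum, mul_zero, zero_add, zero_add, zero_add, h5, h52, Real.Gamma_one]
  have hpi := Real.sq_sqrt Real.pi_pos.le
  have h3 := Real.sq_sqrt (by norm_num : (0:ℝ) ≤ 3)
  have := Real.pi_pos
  rw [show 3/4 * √Real.pi * (3/4 * √Real.pi) = 9/16 * √Real.pi ^ 2 by ring, hpi,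
    div_eq_div_iff (by positivity) (by positivity)]
  linear_combination (-216 * Real.pi) * h3

theorem quarticTerm_five_halves (k : ℕ) :
    (poch (5/2) k * poch (-(3/4)) k * poch (-(1/4)) k) /
      ((k.factorial : ℝ) ^ 2 * ((k + 2).factorial : ℝ)) * ((8*(k : ℝ) + 5) / (9 : ℝ) ^ k) =
    quarticTerm (5/2) k := by
  have hprod : (poch (5/2) k * poch (-(3/4)) k * poch (-(1/4)) k) /
      ((k.factorial : ℝ) ^ 2 * ((k + 2).factorial : ℝ)) / (9 : ℝ) ^ k =
      quarticProd (5/2) k / 2 := by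
    induction k with
    | zero => simp [poch, quarticProd]
    | succ k ih =>
      have hp : ∀ x : ℝ, poch x (k + 1) = poch x k * (x + k) :=
        fun x => Finset.prod_range_succ _ _
      rw [quarticProd_succ, mul_div_right_comm (quarticProd _ _), ← ih, hp, hp, hp, quarticRatio, pow_succ,
        Nat.factorial_succ k, show k + 1 + 2 = k + 2 + 1 from rfl, Nat.factorial_succ (k + 2)]
      have h1 : (k.factorial : ℝ) ≠ 0 := Nat.cast_ne_zero.mpr k.factorial_ne_zero
      have h2 : ((k + 2).factorial : ℝ) ≠ 0 := Nat.cast_ne_zero.mpr (k + 2).factorial_ne_zero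
      push_cast
      have d1 : 3*(k:ℝ) + 5/2 + 1/2 = 3 * (k + 1) := by ring
      have d2 : (5:ℝ)/2 + 5/2 + 2*k = 2 * (k + 5/2) := by ring
      have d3 : (5:ℝ)/2 + 7/2 + 2*k = 2 * (k + 2 + 1) := by ring
      rw [d1, d2, d3]
      have h3 : (k:ℝ) + 5/2 ≠ 0 := by positivity
      field_simp
      ring
  rw [quarticTerm, show quarticProd (5/2) k = 2 * (quarticProd (5/2) k / 2) by ring, ← hprod]
  ring

theorem example_thm7_p0q0 :
    ∑' k : ℕ, (poch (5/2) k * poch (-(3/4)) k * poch (-(1/4)) k) / ((k.factorial : ℝ) ^ 2 * ((k + 2).factorial : ℝ)) * ((8*(k : ℝ) + 5) / (9 : ℝ) ^ k) = 128 * Real.sqrt 3 / (27 * Real.pi) := by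
  rw [tsum_congr quarticTerm_five_halves, tsum_quarticTerm_eq, quarticSum_zero]
end
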